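/- arXiv:0906.0855 — 4 statements merged into one kernel-verified Lean document; each statement's English description precedes it below -/
import Mathlib

section
/- Let S and T be inverse semigroups. Then S and T are strongly Morita equivalent if and only if they are semigroup Morita equivalent, i.e. the category of unitary right S-sets (with S-equivariant maps) is equivalent to the category of unitary right T-sets. -/
universe u

open CategoryTheory

/-- An inverse semigroup: every element has a unique (von Neumann) inverse,
selected by `star`. -/
class InverseSemigroup (S : Type u) extends Semigroup S where
  star : S → S
  mul_star_mul : ∀ s : S, s * star s * s = s
  star_mul_star : ∀ s : S, star s * s * star s = star s
  star_unique : ∀ s t : S, s * t * s = s → t * s * t = t → t = star s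

open InverseSemigroup

/-- A right `S`-set: a set with an associative right action of the semigroup `S`. -/
structure RSet (S : Type u) [Semigroup S] : Type (u + 1) where
  carrier : Type u
  act : carrier → S → carrier
  act_mul : ∀ (x : carrier) (s t : S), act (act x s) t = act x (s * t)

namespace RSet

variable {S : Type u} [Semigroup S]

/-- `S`-equivariant maps between right `S`-sets. -/
@[ext]
structure Hom (X Y : RSet S) where
  toFun : X.carrier → Y.carrier
  map_act : ∀ (x : X.carrier) (s : S), toFun (X.act x s) = Y.act (toFun x) s

/-- A right `S`-set is unitary if every element is of the form `y • s`. -/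
def Unitary (X : RSet S) : Prop := ∀ x : X.carrier, ∃ (y : X.carrier) (s : S), X.act y s = x

instance homCategory {P : RSet S → Prop} : Category.{u} {X : RSet S // P X} where
  Hom X Y := RSet.Hom X.1 Y.1
  id X := ⟨fun x => x, fun _ _ => rfl⟩
  comp f g := ⟨fun x => g.toFun (f.toFun x), fun x s => by
    simp [f.map_act, g.map_act]⟩

end RSet

/-- The category of unitary right `S`-sets, with `S`-equivariant maps. -/
abbrev USet (S : Type u) [Semigroup S] := {X : RSet S // X.Unitary}

/-- Two inverse semigroups are strongly Morita equivalent if there is an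
equivalence biset between them: an `(S,T)`-biset `X` with surjective pairings
`⟨-,-⟩ : X × X → S` and `[-,-] : X × X → T` satisfying (M1)–(M7). -/
def StronglyMoritaEquivalent (S T : Type u) [InverseSemigroup S] [InverseSemigroup T] : Prop :=
  ∃ (X : Type u) (smul : S → X → X) (tmul : X → T → X)
    (inn : X → X → S) (brk : X → X → T),
    (∀ (s₁ s₂ : S) (x : X), smul (s₁ * s₂) x = smul s₁ (smul s₂ x)) ∧
    (∀ (x : X) (t₁ t₂ : T), tmul (tmul x t₁) t₂ = tmul x (t₁ * t₂)) ∧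
    (∀ (s : S) (x : X) (t : T), tmul (smul s x) t = smul s (tmul x t)) ∧
    (Function.Surjective fun p : X × X => inn p.1 p.2) ∧
    (Function.Surjective fun p : X × X => brk p.1 p.2) ∧
    (∀ (s : S) (x y : X), inn (smul s x) y = s * inn x y) ∧
    (∀ x y : X, inn y x = star (inn x y)) ∧
    (∀ x : X, smul (inn x x) x = x) ∧
    (∀ (x y : X) (t : T), brk x (tmul y t) = brk x y * t) ∧
    (∀ x y : X, brk x y = star (brk y x)) ∧
    (∀ x : X, tmul x (brk x x) = x) ∧
    (∀ x y z : X, smul (inn x y) z = tmul x (brk y z))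

namespace MoritaProof

section Basic
variable {S : Type u} [InverseSemigroup S]

lemma idem_mul_idem_aux (e f : S) (he : e * e = e) (hf : f * f = f) :
    (e * f) * (e * f) = e * f ∧ star (e * f) = e * f := by
  have h1 := mul_star_mul (e * f)
  have h2 := InverseSemigroup.star_mul_star (e * f)
  have he' : ∀ x : S, e * (e * x) = e * x := fun x => by rw [← mul_assoc, he]
  have hf' : ∀ x : S, f * (f * x) = f * x := fun x => by rw [← mul_assoc, hf]
  have hz : f * star (e * f) * e = star (e * f) := by
    apply star_unique
    · simp only [mul_assoc, he', hf'] at h1 ⊢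
      exact h1
    · have h3 := congrArg (fun y => f * (y * e)) h2
      simp only [mul_assoc, he', hf'] at h3 ⊢
      exact h3
  have hzz : star (e * f) * star (e * f) = star (e * f) := by
    have h3 := congrArg (fun y => f * (y * e)) h2
    calc star (e * f) * star (e * f)
        = (f * star (e * f) * e) * (f * star (e * f) * e) := by rw [hz]
      _ = f * ((star (e * f) * (e * f) * star (e * f)) * e) := by simp only [mul_assoc]
      _ = f * star (e * f) * e := by rw [h2, mul_assoc]
      _ = star (e * f) := hz
  have h4 : star (e * f) = star (star (e * f)) :=
    star_unique _ _ (by rw [hzz, hzz]) (by rw [hzz, hzz])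
  have h5 : e * f = star (star (e * f)) := star_unique _ _ h2 h1
  have h6 : star (e * f) = e * f := h4.trans h5.symm
  exact ⟨by rw [h6] at hzz; exact hzz, h6⟩

lemma idem_comm (e f : S) (he : e * e = e) (hf : f * f = f) : e * f = f * e := by
  obtain ⟨h1, h2⟩ := idem_mul_idem_aux e f he hf
  obtain ⟨h3, h4⟩ := idem_mul_idem_aux f e hf he
  have he' : ∀ x : S, e * (e * x) = e * x := fun x => by rw [← mul_assoc, he]
  have hf' : ∀ x : S, f * (f * x) = f * x := fun x => by rw [← mul_assoc, hf]
  rw [← h2]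
  symm
  apply star_unique
  · simp only [mul_assoc, he', hf'] at h1 ⊢
    exact h1
  · simp only [mul_assoc, he', hf'] at h3 ⊢
    exact h3

lemma star_star' (s : S) : star (star s) = s :=
  (star_unique _ _ (InverseSemigroup.star_mul_star s) (mul_star_mul s)).symm

lemma star_mul_idem (s : S) : (star s * s) * (star s * s) = star s * s := by
  rw [← mul_assoc, InverseSemigroup.star_mul_star]

lemma mul_star_idem (s : S) : (s * star s) * (s * star s) = s * star s := by
  rw [← mul_assoc, mul_star_mul]

lemma star_idem (e : S) (he : e * e = e) : star e = e :=
  (star_unique _ _ (by rw [he, he]) (by rw [he, he])).symm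

lemma star_mul' (s t : S) : star (s * t) = star t * star s := by
  symm
  have hc := idem_comm _ _ (mul_star_idem t) (star_mul_idem s)
  apply star_unique
  · calc s * t * (star t * star s) * (s * t)
        = s * ((t * star t) * (star s * s)) * t := by simp only [mul_assoc]
      _ = s * ((star s * s) * (t * star t)) * t := by rw [hc]
      _ = (s * star s * s) * (t * star t * t) := by simp only [mul_assoc]
      _ = s * t := by rw [mul_star_mul, mul_star_mul]
  · calc star t * star s * (s * t) * (star t * star s)
        = star t * ((star s * s) * (t * star t)) * star s := by simp only [mul_assoc]
      _ = star t * ((t * star t) * (star s * s)) * star s := by rw [hc]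
      _ = (star t * t * star t) * (star s * s * star s) := by simp only [mul_assoc]
      _ = star t * star s := by rw [InverseSemigroup.star_mul_star, InverseSemigroup.star_mul_star]

/-- Elements of a unitary set are fixed by some idempotent. -/
lemma exists_idem (A : RSet S) (hA : A.Unitary) (a : A.carrier) :
    ∃ e : S, e * e = e ∧ A.act a e = a := by
  obtain ⟨y, s, rfl⟩ := hA a
  exact ⟨star s * s, star_mul_idem s, by rw [A.act_mul, ← mul_assoc, mul_star_mul]⟩

lemma unitary_ext (A : RSet S) (hA : A.Unitary) (a b : A.carrier)
    (h : ∀ s, A.act a s = A.act b s) : a = b := by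
  obtain ⟨e, he, hae⟩ := exists_idem A hA a
  obtain ⟨f, hf, hbf⟩ := exists_idem A hA b
  calc a = A.act a e := hae.symm
    _ = A.act b e := h e
    _ = A.act (A.act b f) e := by rw [hbf]
    _ = A.act b (f * e) := A.act_mul _ _ _
    _ = A.act a (e * f) := by rw [← h, idem_comm e f he hf]
    _ = A.act (A.act a e) f := (A.act_mul _ _ _).symm
    _ = A.act b f := by rw [hae, h]
    _ = b := hbf

/-- `S` as a right `S`-set. -/
def reg (S : Type u) [InverseSemigroup S] : USet S :=
  ⟨⟨S, fun a s => a * s, fun a s t => mul_assoc a s t⟩,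
    fun s => ⟨s, star s * s, by
      change s * (star s * s) = s
      rw [← mul_assoc, mul_star_mul]⟩⟩

lemma left_ext (s t : S) (h : ∀ c, s * c = t * c) : s = t :=
  unitary_ext (reg S).1 (reg S).2 s t h

end Basic

/-! ### From bisets to equivalences -/

/-- Morita contexts. -/
structure Ctx (S T : Type u) [InverseSemigroup S] [InverseSemigroup T] where
  X : Type u
  Y : Type u
  sx : S → X → X
  xt : X → T → X
  ty : T → Y → Y
  ys : Y → S → Y
  p : X → Y → S
  q : Y → X → T
  sx_mul : ∀ s s' x, sx (s * s') x = sx s (sx s' x)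
  xt_mul : ∀ x t t', xt (xt x t) t' = xt x (t * t')
  ty_mul : ∀ t t' y, ty (t * t') y = ty t (ty t' y)
  ys_mul : ∀ y s s', ys (ys y s) s' = ys y (s * s')
  sxt : ∀ s x t, xt (sx s x) t = sx s (xt x t)
  tys : ∀ t y s, ys (ty t y) s = ty t (ys y s)
  p_left : ∀ s x y, p (sx s x) y = s * p x y
  p_mid : ∀ x t y, p (xt x t) y = p x (ty t y)
  p_right : ∀ x y s, p x (ys y s) = p x y * s
  q_left : ∀ t y x, q (ty t y) x = t * q y x
  q_mid : ∀ y s x, q (ys y s) x = q y (sx s x)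
  q_right : ∀ y x t, q y (xt x t) = q y x * t
  pq : ∀ x y z, sx (p x y) z = xt x (q y z)
  qp : ∀ y x z, ty (q y x) z = ys y (p x z)
  p_surj : ∀ s, ∃ x y, p x y = s
  q_surj : ∀ t, ∃ y x, q y x = t
  x_unit : ∀ x, ∃ t, xt x t = x
  y_unit : ∀ y, ∃ s, ys y s = y

namespace Ctx
variable {S T : Type u} [InverseSemigroup S] [InverseSemigroup T]

/-- The opposite context. -/
def op (c : Ctx S T) : Ctx T S where
  X := c.Y
  Y := c.X
  sx := c.ty
  xt := c.ys
  ty := c.sx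
  ys := c.xt
  p := c.q
  q := c.p
  sx_mul := c.ty_mul
  xt_mul := c.ys_mul
  ty_mul := c.sx_mul
  ys_mul := c.xt_mul
  sxt := c.tys
  tys := c.sxt
  p_left := c.q_left
  p_mid := c.q_mid
  p_right := c.q_right
  q_left := c.p_left
  q_mid := c.p_mid
  q_right := c.p_right
  pq := c.qp
  qp := c.pq
  p_surj := c.q_surj
  q_surj := c.p_surj
  x_unit := c.y_unit
  y_unit := c.x_unit

/-- Carrier of the hom set. -/
def HomC (c : Ctx S T) (A : RSet S) : Type u :=
  {k : c.Y → A.carrier // (∀ y s, k (c.ys y s) = A.act (k y) s) ∧ ∃ t, ∀ y, k (c.ty t y) = k y}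

/-- The hom set as a right `T`-set. -/
def homR (c : Ctx S T) (A : RSet S) : RSet T where
  carrier := c.HomC A
  act k t := ⟨fun y => k.1 (c.ty t y), fun y s =>
      (congrArg k.1 (c.tys t y s).symm).trans (k.2.1 _ s),
    star t * t, fun y => congrArg k.1 (by rw [← c.ty_mul, ← mul_assoc, mul_star_mul])⟩
  act_mul k s t := by
    apply Subtype.ext
    funext y
    change k.1 (c.ty s (c.ty t y)) = k.1 (c.ty (s * t) y)
    rw [c.ty_mul]

/-- The functor. -/
def hom (c : Ctx S T) : USet S ⥤ USet T where
  obj A := ⟨c.homR A.1, fun k => by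
    obtain ⟨t, ht⟩ := k.2.2
    exact ⟨k, t, Subtype.ext (funext ht)⟩⟩
  map {A B} f := RSet.Hom.mk (X := c.homR A.1) (Y := c.homR B.1)
    (fun k => ⟨fun y => RSet.Hom.toFun f (k.1 y), fun y s =>
      (congrArg (RSet.Hom.toFun f) (k.2.1 y s)).trans (RSet.Hom.map_act f _ s), by
      obtain ⟨t, ht⟩ := k.2.2
      exact ⟨t, fun y => congrArg (RSet.Hom.toFun f) (ht y)⟩⟩) (fun k t => rfl)
  map_id A := rfl
  map_comp f g := rfl

/-- Unit on underlying sets. -/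
def unitFun (c : Ctx S T) (A : USet S) (a : A.1.carrier) :
    ((c.hom ⋙ c.op.hom).obj A).1.carrier :=
  ⟨fun x => ⟨fun y => A.1.act a (c.p x y), fun y s =>
      (congrArg (A.1.act a) (c.p_right x y s)).trans (A.1.act_mul _ _ _).symm, by
      obtain ⟨t, ht⟩ := c.x_unit x
      exact ⟨t, fun y => congrArg (A.1.act a)
        ((c.p_mid x t y).symm.trans (congrArg (fun z => c.p z y) ht))⟩⟩,
    fun x t => Subtype.ext (funext fun y => congrArg (A.1.act a) (c.p_mid x t y)), by
    obtain ⟨e, -, he⟩ := exists_idem A.1 A.2 a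
    refine ⟨e, fun x => Subtype.ext (funext fun y => ?_)⟩
    have h : ∀ x : c.X, A.1.act a (c.p (c.sx e x) y) = A.1.act a (c.p x y) := fun x => by
      rw [c.p_left, ← A.1.act_mul, he]
    exact h x⟩

lemma unitFun_bij (c : Ctx S T) (A : USet S) : Function.Bijective (c.unitFun A) := by
  constructor
  · intro a b h
    apply unitary_ext A.1 A.2
    intro s
    obtain ⟨x, y, rfl⟩ := c.p_surj s
    exact congrFun (congrArg Subtype.val (congrFun (congrArg Subtype.val h) x)) y
  · intro h
    obtain ⟨h, h1, e, h2⟩ := h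
    obtain ⟨x, y, rfl⟩ := c.p_surj e
    refine ⟨(h x).1 y, Subtype.ext (funext fun z => Subtype.ext (funext fun w => ?_))⟩
    change A.1.act ((h x).1 y) (c.p z w) = (h z).1 w
    have h3 : h (c.sx (c.p x y) z) = h z := h2 z
    have h4 : h (c.xt x (c.q y z)) = (c.homR A.1).act (h x) (c.q y z) := h1 x _
    have h5 : h (c.sx (c.p x y) z) = h (c.xt x (c.q y z)) := congrArg h (c.pq x y z)
    have h6 : h z = (c.homR A.1).act (h x) (c.q y z) := h3.symm.trans (h5.trans h4)
    have h7 : (h z).1 w = (h x).1 (c.ty (c.q y z) w) :=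
      congrFun (congrArg Subtype.val h6) w
    have h8 : (h x).1 (c.ty (c.q y z) w) = (h x).1 (c.ys y (c.p z w)) :=
      congrArg (h x).1 (c.qp y z w)
    exact (h7.trans (h8.trans ((h x).2.1 y (c.p z w)))).symm

/-- Unit as a morphism. -/
def unitHom (c : Ctx S T) (A : USet S) : A ⟶ (c.hom ⋙ c.op.hom).obj A :=
  RSet.Hom.mk (X := A.1) (Y := ((c.hom ⋙ c.op.hom).obj A).1) (c.unitFun A) (fun a s => by
    apply Subtype.ext
    funext x
    apply Subtype.ext
    funext y
    have h : ∀ x : c.X, A.1.act (A.1.act a s) (c.p x y) = A.1.act a (c.p (c.sx s x) y) :=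
      fun x => by rw [c.p_left, A.1.act_mul]
    exact h x)

end Ctx

lemma isIso_of_bij {S : Type u} [InverseSemigroup S] {A B : USet S} (f : A ⟶ B)
    (h : Function.Bijective (RSet.Hom.toFun f)) : IsIso f := by
  obtain ⟨g, h1, h2⟩ := Function.bijective_iff_has_inverse.mp h
  refine ⟨RSet.Hom.mk (X := B.1) (Y := A.1) g (fun b s => ?_), ?_, ?_⟩
  · apply h.1
    rw [RSet.Hom.map_act, h2, h2]
  · exact RSet.Hom.ext (funext h1)
  · exact RSet.Hom.ext (funext h2)

namespace Ctx
variable {S T : Type u} [InverseSemigroup S] [InverseSemigroup T]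

/-- Natural unit isomorphism. -/
noncomputable def unitIso (c : Ctx S T) : 𝟭 (USet S) ≅ c.hom ⋙ c.op.hom :=
  NatIso.ofComponents
    (fun A => @asIso _ _ _ _ (c.unitHom A) (isIso_of_bij _ (c.unitFun_bij A)))
    (fun {A B} f => by
      apply RSet.Hom.ext
      funext a
      apply Subtype.ext
      funext x
      apply Subtype.ext
      funext y
      exact (RSet.Hom.map_act f a (c.p x y)).symm)

/-- The equivalence. -/
noncomputable def equiv (c : Ctx S T) : USet S ≌ USet T :=
  CategoryTheory.Equivalence.mk c.hom c.op.hom c.unitIso c.op.unitIso.symm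

end Ctx

theorem forward (S T : Type u) [InverseSemigroup S] [InverseSemigroup T]
    (h : StronglyMoritaEquivalent S T) : Nonempty (USet S ≌ USet T) := by
  obtain ⟨X, smul, tmul, inn, brk, hs, ht, hst, is, bs, m1, m2, m3, m4, m5, m6, m7⟩ := h
  have inn_r : ∀ x y s, inn x (smul s y) = inn x y * star s := fun x y s => by
    rw [m2, m1, star_mul', ← m2]
  have brk_l : ∀ x y t, brk (tmul x t) y = star t * brk x y := fun x y t => by
    rw [m5, m4, star_mul', ← m5]
  have pmid : ∀ x t y, inn (tmul x t) y = inn x (tmul y (star t)) := fun x t y => by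
    apply left_ext
    intro c
    obtain ⟨⟨z, w⟩, rfl⟩ := is c
    simp only
    rw [← m1, ← m1, m7, m7, brk_l, star_star', ht]
  have right_ext : ∀ s t : T, (∀ c, c * s = c * t) → s = t := fun s t h => by
    rw [← star_star' s, ← star_star' t]
    congr 1
    apply left_ext
    intro c
    rw [← star_star' c, ← star_mul', h, star_mul']
  have qmid : ∀ y s x, brk (smul (star s) y) x = brk y (smul s x) := fun y s x => by
    apply right_ext
    intro c
    obtain ⟨⟨z, w⟩, rfl⟩ := bs c
    simp only
    rw [← m4, ← m4, ← m7, ← m7, inn_r, star_star', hs]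
  refine ⟨Ctx.equiv
    { X := X, Y := X, sx := smul, xt := tmul
      ty := fun t y => tmul y (star t), ys := fun y s => smul (star s) y
      p := inn, q := brk
      sx_mul := hs
      xt_mul := ht
      ty_mul := fun t t' y => by rw [star_mul', ht]
      ys_mul := fun y s s' => by rw [star_mul', hs]
      sxt := hst
      tys := fun t y s => (hst _ _ _).symm
      p_left := m1
      p_mid := pmid
      p_right := fun x y s => by rw [inn_r, star_star']
      q_left := fun t y x => by rw [brk_l, star_star']
      q_mid := qmid
      q_right := m4
      pq := m7
      qp := fun y x z => by rw [← m5, ← m2, m7]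
      p_surj := fun s => ?_
      q_surj := fun s => ?_
      x_unit := fun x => ⟨_, m6 x⟩
      y_unit := fun x => ⟨star (inn x x), by rw [star_star', m3]⟩ }⟩
  · obtain ⟨⟨z, w⟩, h⟩ := is s
    exact ⟨z, w, h⟩
  · obtain ⟨⟨z, w⟩, h⟩ := bs s
    exact ⟨z, w, h⟩

/-! ### From equivalences to bisets -/

section Abstract

variable {S T : Type u} [InverseSemigroup S] [InverseSemigroup T]
  {D : Type (u+1)} [Category.{u} D]

/-- A corner-full faithful (left) representation of `S` on an object. -/
structure Rep (S : Type u) [InverseSemigroup S] (X : D) where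
  l : S → (X ⟶ X)
  mul : ∀ s t, l (s * t) = l t ≫ l s
  inj : Function.Injective l
  full : ∀ (θ : X ⟶ X) (e : S), l e ≫ θ = θ → ∃ s, l s = θ

/-- Elements of the biset. -/
structure Elt {X Y : D} (i : Rep S X) (j : Rep T Y) where
  a : X ⟶ Y
  b : Y ⟶ X
  aba : a ≫ b ≫ a = a
  bab : b ≫ a ≫ b = b
  e : S
  f : T
  he : i.l e = a ≫ b
  hf : j.l f = b ≫ a

variable {X Y : D} {i : Rep S X} {j : Rep T Y}

namespace Elt

/-- Opposite element. -/
def op (x : Elt i j) : Elt j i :=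
  ⟨x.b, x.a, x.bab, x.aba, x.f, x.e, x.hf, x.he⟩

@[ext]
lemma ext' {x y : Elt i j} (ha : x.a = y.a) (hb : x.b = y.b) : x = y := by
  obtain ⟨a, b, h1, h2, e, f, he, hf⟩ := x
  obtain ⟨a', b', h1', h2', e', f', he', hf'⟩ := y
  dsimp at ha hb
  subst ha hb
  have : e = e' := i.inj (he.trans he'.symm)
  have : f = f' := j.inj (hf.trans hf'.symm)
  subst_vars
  rfl

lemma e_idem (x : Elt i j) : x.e * x.e = x.e := by
  apply i.inj
  rw [i.mul, x.he, Category.assoc, x.bab]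

lemma f_idem (x : Elt i j) : x.f * x.f = x.f := x.op.e_idem

lemma exists_inn (x y : Elt i j) : ∃ s, i.l s = y.a ≫ x.b :=
  i.full _ y.e (by rw [y.he, Category.assoc]; simp only [← Category.assoc]; rw [Category.assoc y.a, y.aba])

/-- The inner product. -/
noncomputable def inn (x y : Elt i j) : S := (exists_inn x y).choose

lemma inn_spec (x y : Elt i j) : i.l (inn x y) = y.a ≫ x.b := (exists_inn x y).choose_spec

lemma inn_star (x y : Elt i j) : inn y x = star (inn x y) := by
  have key : ∀ x y : Elt i j, inn x y * inn y x * inn x y = inn x y := by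
    intro x y
    apply i.inj
    have hc := congrArg j.l (idem_comm _ _ x.f_idem y.f_idem)
    rw [j.mul, j.mul, x.hf, y.hf] at hc
    rw [i.mul, i.mul, inn_spec, inn_spec]
    calc (y.a ≫ x.b) ≫ (x.a ≫ y.b) ≫ y.a ≫ x.b
        = y.a ≫ ((x.b ≫ x.a) ≫ (y.b ≫ y.a)) ≫ x.b := by simp only [Category.assoc]
      _ = y.a ≫ ((y.b ≫ y.a) ≫ (x.b ≫ x.a)) ≫ x.b := by rw [hc]
      _ = (y.a ≫ y.b ≫ y.a) ≫ (x.b ≫ x.a ≫ x.b) := by simp only [Category.assoc]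
      _ = y.a ≫ x.b := by rw [x.bab, y.aba]
  exact star_unique _ _ (key x y) (key y x)

lemma smul_aux (s : S) (x : Elt i j) :
    x.a ≫ x.b ≫ i.l s ≫ i.l (star s) = i.l s ≫ i.l (star s) ≫ x.a ≫ x.b := by
  have hc := congrArg i.l (idem_comm _ _ (star_mul_idem s) x.e_idem)
  simp only [i.mul, x.he] at hc
  simpa only [Category.assoc] using hc

lemma l3 (s : S) : i.l s ≫ i.l (star s) ≫ i.l s = i.l s := by
  rw [← i.mul, ← i.mul, mul_star_mul]

lemma l3' (s : S) : i.l (star s) ≫ i.l s ≫ i.l (star s) = i.l (star s) := by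
  rw [← i.mul, ← i.mul, InverseSemigroup.star_mul_star]

lemma exists_smul_f (s : S) (x : Elt i j) :
    ∃ t, j.l t = (x.b ≫ i.l s) ≫ (i.l (star s) ≫ x.a) :=
  j.full _ x.f (by
    rw [x.hf]
    have := x.bab
    calc (x.b ≫ x.a) ≫ (x.b ≫ i.l s) ≫ (i.l (star s) ≫ x.a)
        = (x.b ≫ x.a ≫ x.b) ≫ i.l s ≫ (i.l (star s) ≫ x.a) := by simp only [Category.assoc]
      _ = _ := by rw [x.bab, Category.assoc])

lemma exists_smul_e (s : S) (x : Elt i j) :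
    ∃ t, i.l t = (i.l (star s) ≫ x.a) ≫ (x.b ≫ i.l s) :=
  ⟨s * x.e * star s, by rw [i.mul, i.mul, x.he]; simp only [Category.assoc]⟩

/-- Left action. -/
noncomputable def smul (s : S) (x : Elt i j) : Elt i j where
  a := i.l (star s) ≫ x.a
  b := x.b ≫ i.l s
  aba := by
    calc (i.l (star s) ≫ x.a) ≫ (x.b ≫ i.l s) ≫ i.l (star s) ≫ x.a
        = i.l (star s) ≫ (x.a ≫ x.b ≫ i.l s ≫ i.l (star s)) ≫ x.a := by
          simp only [Category.assoc]
      _ = (i.l (star s) ≫ i.l s ≫ i.l (star s)) ≫ (x.a ≫ x.b ≫ x.a) := by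
          rw [smul_aux]; simp only [Category.assoc]
      _ = _ := by rw [l3', x.aba]
  bab := by
    calc (x.b ≫ i.l s) ≫ (i.l (star s) ≫ x.a) ≫ x.b ≫ i.l s
        = x.b ≫ (i.l s ≫ i.l (star s) ≫ x.a ≫ x.b) ≫ i.l s := by
          simp only [Category.assoc]
      _ = (x.b ≫ x.a ≫ x.b) ≫ (i.l s ≫ i.l (star s) ≫ i.l s) := by
          rw [← smul_aux]; simp only [Category.assoc]
      _ = _ := by rw [l3, x.bab]
  e := (exists_smul_e s x).choose
  f := (exists_smul_f s x).choose
  he := (exists_smul_e s x).choose_spec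
  hf := (exists_smul_f s x).choose_spec

lemma smul_a (s : S) (x : Elt i j) : (smul s x).a = i.l (star s) ≫ x.a := rfl
lemma smul_b (s : S) (x : Elt i j) : (smul s x).b = x.b ≫ i.l s := rfl

/-- Right action. -/
noncomputable def tmul (x : Elt i j) (t : T) : Elt i j := (smul (star t) x.op).op

lemma tmul_a (x : Elt i j) (t : T) : (tmul x t).a = x.a ≫ j.l (star t) := rfl
lemma tmul_b (x : Elt i j) (t : T) : (tmul x t).b = j.l t ≫ x.b := by
  change j.l (star (star t)) ≫ x.b = _
  rw [star_star']

/-- Right inner product. -/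
noncomputable def brk (x y : Elt i j) : T := inn x.op y.op

lemma brk_spec (x y : Elt i j) : j.l (brk x y) = y.b ≫ x.a := inn_spec x.op y.op

lemma brk_star (x y : Elt i j) : brk x y = star (brk y x) := inn_star y.op x.op

end Elt

open Elt in
theorem abstract_sme (i : Rep S X) (j : Rep T Y)
    (h1 : ∀ e : S, e * e = e → ∃ x : Elt i j, x.a ≫ x.b = i.l e)
    (h2 : ∀ f : T, f * f = f → ∃ x : Elt i j, x.b ≫ x.a = j.l f) :
    StronglyMoritaEquivalent S T := by
  refine ⟨Elt i j, smul, tmul, inn, brk, ?_, ?_, ?_, ?_, ?_, ?_, inn_star, ?_, ?_, brk_star, ?_, ?_⟩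
  · intro s t x
    ext
    · simp only [smul_a, star_mul', i.mul, Category.assoc]
    · simp only [smul_b, i.mul, Category.assoc]
  · intro x s t
    ext
    · simp only [tmul_a, star_mul', j.mul, Category.assoc]
    · simp only [tmul_b, j.mul, Category.assoc]
  · intro s x t
    ext
    · simp only [tmul_a, smul_a, Category.assoc]
    · simp only [tmul_b, smul_b, Category.assoc]
  · intro s
    obtain ⟨x, hx⟩ := h1 _ (star_mul_idem s)
    refine ⟨(smul s x, x), i.inj ?_⟩
    change i.l (inn (smul s x) x) = _
    rw [inn_spec, smul_b, ← Category.assoc, hx, ← i.mul, ← mul_assoc, mul_star_mul]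
  · intro t
    obtain ⟨x, hx⟩ := h2 _ (mul_star_idem t)
    refine ⟨(x, tmul x t), j.inj ?_⟩
    change j.l (brk x (tmul x t)) = _
    rw [brk_spec, tmul_b, Category.assoc, hx, ← j.mul, mul_star_mul]
  · intro s x y
    apply i.inj
    rw [inn_spec, smul_b, i.mul, inn_spec, Category.assoc]
  · intro x
    ext
    · rw [smul_a, ← inn_star, inn_spec, Category.assoc, x.aba]
    · rw [smul_b, inn_spec, x.bab]
  · intro x y t
    apply j.inj
    rw [brk_spec, tmul_b, j.mul, brk_spec, Category.assoc]
  · intro x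
    ext
    · rw [tmul_a, ← brk_star, brk_spec, x.aba]
    · rw [tmul_b, brk_spec, Category.assoc, x.bab]
  · intro x y z
    ext
    · rw [smul_a, tmul_a, ← inn_star, ← brk_star, inn_spec, brk_spec, Category.assoc]
    · rw [smul_b, tmul_b, inn_spec, brk_spec, Category.assoc]

/-- Building elements from one-sided data. -/
lemma exists_elt (i : Rep S X) (j : Rep T Y) (e : S) (he : e * e = e) (g : T)
    (α : X ⟶ Y) (β : Y ⟶ X) (hαβ : α ≫ β = i.l e) (hβ : j.l g ≫ β = β) :
    ∃ x : Elt i j, x.a ≫ x.b = i.l e := by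
  have hee : i.l e ≫ i.l e = i.l e := by rw [← i.mul, he]
  have hee' : ∀ {Z : D} (h : X ⟶ Z), i.l e ≫ i.l e ≫ h = i.l e ≫ h := fun h => by
    rw [← Category.assoc, hee]
  have hαβ' : ∀ {Z : D} (h : X ⟶ Z), α ≫ β ≫ h = i.l e ≫ h := fun h => by
    rw [← Category.assoc, hαβ]
  obtain ⟨f, hf⟩ := j.full ((β ≫ i.l e) ≫ (i.l e ≫ α)) g (by
    simp only [← Category.assoc]; rw [hβ])
  refine ⟨⟨i.l e ≫ α, β ≫ i.l e, ?_, ?_, e, f, ?_, hf⟩, ?_⟩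
  all_goals simp only [Category.assoc, hee', hαβ', hee]

end Abstract

section Cover

variable {S T : Type u} [InverseSemigroup S] [InverseSemigroup T]

/-- Apply a morphism. -/
def ap {A B : USet S} (f : A ⟶ B) (a : A.1.carrier) : B.1.carrier := RSet.Hom.toFun f a

lemma ap_comp {A B C : USet S} (f : A ⟶ B) (g : B ⟶ C) (a : A.1.carrier) :
    ap (f ≫ g) a = ap g (ap f a) := rfl

lemma ap_act {A B : USet S} (f : A ⟶ B) (a : A.1.carrier) (s : S) :
    ap f (A.1.act a s) = B.1.act (ap f a) s := RSet.Hom.map_act f a s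

lemma hom_ext {A B : USet S} (f g : A ⟶ B) (h : ∀ a, ap f a = ap g a) : f = g :=
  RSet.Hom.ext (funext h)

/-- The morphism `s ↦ a s`. -/
def orb (A : USet S) (a : A.1.carrier) : reg S ⟶ A :=
  RSet.Hom.mk (X := (reg S).1) (Y := A.1) (fun s => A.1.act a s)
    (fun s t => (A.1.act_mul a s t).symm)

lemma ap_orb (A : USet S) (a : A.1.carrier) (s : S) : ap (orb A a) s = A.1.act a s := rfl

/-- Left multiplication. -/
def lam (s : S) : reg S ⟶ reg S := orb (reg S) s

lemma ap_lam (s t : S) : ap (lam s) t = s * t := rfl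

/-- The regular representation. -/
def regRep (S : Type u) [InverseSemigroup S] : Rep S (reg S) where
  l := lam
  mul s t := hom_ext _ _ fun a => mul_assoc s t a
  inj s t h := left_ext s t fun c =>
    congrArg (fun f : reg S ⟶ reg S => (ap f c : S)) h
  full θ e h := ⟨ap θ e, hom_ext _ _ fun a => by
    have h1 := congrArg (fun f => ap f a) h
    exact (ap_act θ e a).symm.trans h1⟩

/-- Transport along an equivalence. -/
def mapRep (E : USet S ≌ USet T) : Rep S (E.functor.obj (reg S)) where
  l s := E.functor.map (lam s)
  mul s t := by rw [← E.functor.map_comp]; exact congrArg _ ((regRep S).mul s t)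
  inj s t h := (regRep S).inj (E.functor.map_injective h)
  full θ e h := by
    obtain ⟨φ, rfl⟩ := E.functor.map_surjective θ
    rw [← E.functor.map_comp] at h
    obtain ⟨s, hs⟩ := (regRep S).full φ e (E.functor.map_injective h)
    exact ⟨s, congrArg _ hs⟩

open Classical in
/-- Rees quotient by a sub-`S`-set, with a zero. -/
noncomputable def rees (A : USet S) (U : A.1.carrier → Prop)
    (hU : ∀ a s, U a → U (A.1.act a s)) (s₀ : S) : USet S :=
  ⟨{ carrier := Option {a : A.1.carrier // ¬ U a}
     act := fun z s => z.elim none (fun a => if h : U (A.1.act a.1 s) then none else some ⟨_, h⟩)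
     act_mul := fun z s t => by
      rcases z with _ | ⟨a, ha⟩
      · rfl
      · simp only [Option.elim]
        by_cases h : U (A.1.act a s)
        · have h' : U (A.1.act a (s * t)) := by rw [← A.1.act_mul]; exact hU _ _ h
          simp [h, h']
        · simp only [h, A.1.act_mul, dif_neg, not_false_iff] },
    fun z => by
      rcases z with _ | ⟨a, ha⟩
      · exact ⟨none, s₀, rfl⟩
      · obtain ⟨e, -, he⟩ := exists_idem A.1 A.2 a
        refine ⟨some ⟨a, ha⟩, e, ?_⟩
        simp [he, ha]⟩

open Classical in
/-- If two maps agreeing on `U` always coincide then `U` is everything. -/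
lemma sub_full (A : USet S) (U : A.1.carrier → Prop)
    (hU : ∀ a s, U a → U (A.1.act a s))
    (h : ∀ (Z : USet S) (p q : A ⟶ Z), (∀ a, U a → ap p a = ap q a) → p = q)
    (a : A.1.carrier) : U a := by
  obtain ⟨s₀, -, -⟩ := exists_idem A.1 A.2 a
  let Z := rees A U hU s₀
  let p : A ⟶ Z := RSet.Hom.mk (X := A.1) (Y := Z.1)
    (fun a => if h : U a then none else some ⟨a, h⟩) (fun a s => by
      by_cases ha : U a
      · have := hU a s ha
        exact (dif_pos this).trans (congrArg (fun z => Z.1.act z s)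
          (dif_pos ha : (if h : U a then none else some ⟨a, h⟩ :
            Option {a : A.1.carrier // ¬ U a}) = none)).symm
      · exact (congrArg (fun z => Z.1.act z s)
          (dif_neg ha : (if h : U a then none else some ⟨a, h⟩ :
            Option {a : A.1.carrier // ¬ U a}) = some ⟨a, ha⟩)).symm)
  let q : A ⟶ Z := RSet.Hom.mk (X := A.1) (Y := Z.1) (fun _ => none) (fun a s => rfl)
  have hpq := h Z p q (fun a ha => by
    change (if h : U a then none else some ⟨a, h⟩ : Option {a : A.1.carrier // ¬ U a}) = none
    simp [ha])
  by_contra hna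
  have h2 : (if h : U a then none else some ⟨a, h⟩ : Option {a : A.1.carrier // ¬ U a}) = none :=
    congrArg (fun f => ap f a) hpq
  simp [hna] at h2

lemma cover (E : USet S ≌ USet T) (e : S) :
    ∃ (g : T) (α : E.functor.obj (reg S) ⟶ reg T) (β : reg T ⟶ E.functor.obj (reg S)),
      α ≫ β = E.functor.map (lam e) ∧ lam g ≫ β = β := by
  let adj := E.symm.toAdjunction
  let ψ : ∀ x : (E.functor.obj (reg S)).1.carrier, E.inverse.obj (reg T) ⟶ reg S :=
    fun x => (adj.homEquiv (reg T) (reg S)).symm (orb _ x)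
  have hψ : ∀ x, adj.unit.app (reg T) ≫ E.functor.map (ψ x) = orb _ x := fun x => by
    have := (adj.homEquiv (reg T) (reg S)).apply_symm_apply (orb _ x)
    rw [adj.homEquiv_unit] at this
    exact this
  have key : ∃ x w, ap (ψ x) w = e := by
    refine sub_full (reg S) (fun s => ∃ x w, ap (ψ x) w = s) ?_ ?_ e
    · rintro _ s ⟨x, w, rfl⟩
      exact ⟨x, _, ap_act _ w s⟩
    · intro Z p q hpq
      apply E.functor.map_injective
      apply hom_ext
      intro y
      obtain ⟨x, t, rfl⟩ := (E.functor.obj (reg S)).2 y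
      have h1 : ψ x ≫ p = ψ x ≫ q := hom_ext _ _ fun w => hpq _ ⟨x, w, rfl⟩
      have h2 : orb _ x ≫ E.functor.map p = orb _ x ≫ E.functor.map q := by
        rw [← hψ, Category.assoc, Category.assoc]
        erw [← E.functor.map_comp, ← E.functor.map_comp]
        rw [h1]
      exact congrArg (fun f => ap f t) h2
  obtain ⟨x, w, hw⟩ := key
  obtain ⟨g, -, hg⟩ := exists_idem _ (E.functor.obj (reg S)).2 x
  have hσ : orb _ w ≫ ψ x = lam e := hom_ext _ _ fun s => by
    have h1 : ap (ψ x) ((E.inverse.obj (reg T)).1.act w s) = (reg S).1.act (ap (ψ x) w) s :=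
      ap_act _ _ _
    rw [hw] at h1
    exact h1
  refine ⟨g, E.functor.map (orb _ w) ≫ E.counit.app (reg T), orb _ x, ?_, ?_⟩
  · rw [← hψ, ← hσ, E.functor.map_comp, Category.assoc]
    congr 1
    have : E.counit.app (reg T) ≫ adj.unit.app (reg T) = 𝟙 _ := by
      simp [adj]
    rw [← Category.assoc]
    erw [this]
    exact Category.id_comp _
  · apply hom_ext
    intro t
    have h1 := (E.functor.obj (reg S)).1.act_mul x g t
    rw [hg] at h1
    exact h1.symm

theorem backward (E : USet S ≌ USet T) : StronglyMoritaEquivalent S T := by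
  apply abstract_sme (mapRep E) (regRep T)
  · intro e he
    obtain ⟨g, α, β, h1, h2⟩ := cover E e
    exact exists_elt _ _ e he g α β h1 h2
  · intro f hf
    obtain ⟨g, α, β, h1, h2⟩ := cover E.symm f
    obtain ⟨x, hx⟩ := exists_elt (regRep T) (mapRep E) f hf g
      (E.counitInv.app (reg T) ≫ E.functor.map α) (E.functor.map β ≫ E.counit.app (reg T))
      (by
        have h3 : E.functor.map α ≫ E.functor.map β = E.functor.map (E.inverse.map (lam f)) := by
          rw [← E.functor.map_comp]; exact congrArg _ h1
        rw [Category.assoc, ← Category.assoc (E.functor.map α), h3]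
        simp [regRep])
      (by
        rw [← Category.assoc]
        congr 1
        exact (E.functor.map_comp _ _).symm.trans (congrArg _ h2))
    exact ⟨x.op, hx⟩

end Cover

end MoritaProof

/-- Two inverse semigroups are strongly Morita equivalent if and only if they are
semigroup Morita equivalent, i.e. their categories of unitary right actions are
equivalent. -/
theorem stronglyMoritaEquivalent_iff_uset_equivalence
    (S T : Type u) [InverseSemigroup S] [InverseSemigroup T] :
    StronglyMoritaEquivalent S T ↔ Nonempty (USet S ≌ USet T) :=
  ⟨MoritaProof.forward S T, fun ⟨E⟩ => MoritaProof.backward E⟩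
end

section
/- Let S and T be inverse semigroups. Then S and T are strongly Morita equivalent if and only if the presheaf categories PSh(L(S)) and PSh(L(T)) are equivalent (that is, S and T are topos Morita equivalent, their classifying toposes being equivalent). -/
universe u

open CategoryTheory

namespace InverseSemigroup

variable {S : Type u} [InverseSemigroup S]

theorem star_star (s : S) : star (star s) = s :=
  (star_unique (star s) s (star_mul_star s) (mul_star_mul s)).symm

theorem star_idem {e : S} (he : e * e = e) : star e = e :=
  (star_unique e e (by rw [he, he]) (by rw [he, he])).symm

theorem mul_idem {e f : S} (he : e * e = e) (hf : f * f = f) :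
    (e * f) * (e * f) = e * f := by
  set x := star (e * f) with hx
  have hxfix : (e * f) * x * (e * f) = e * f := mul_star_mul (e * f)
  have hxfix' : x * (e * f) * x = x := star_mul_star (e * f)
  have he1 : ∀ y : S, e * (e * y) = e * y := fun y => by rw [← mul_assoc, he]
  have hf1 : ∀ y : S, f * (f * y) = f * y := fun y => by rw [← mul_assoc, hf]
  have A : e * (f * (x * (e * f))) = e * f := by
    simpa only [mul_assoc] using hxfix
  have B1 : ∀ y : S, x * (e * (f * (x * y))) = x * y := fun y => by
    have h := congrArg (· * y) hxfix'
    simpa only [mul_assoc] using h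
  have h1 : (e * f) * (f * x * e) * (e * f) = e * f := by
    simp only [mul_assoc, hf1, he1]
    exact A
  have h2 : (f * x * e) * (e * f) * (f * x * e) = f * x * e := by
    simp only [mul_assoc, he1, hf1, B1]
  have hC : f * x * e = x := by
    have := star_unique (e * f) (f * x * e) h1 h2
    rwa [← hx] at this
  have hCn : f * (x * e) = x := by simpa only [mul_assoc] using hC
  have key : (f * (x * e)) * (f * (x * e)) = f * (x * e) := by
    simp only [mul_assoc, B1]
  have hD : x * x = x := by rw [← hCn]; exact key
  have hE : e * f = x := (star_unique x (e * f) hxfix' hxfix).trans (star_idem hD)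
  rw [hE]; exact hD

theorem idem_comm {e f : S} (he : e * e = e) (hf : f * f = f) :
    e * f = f * e := by
  have hef : (e * f) * (e * f) = e * f := mul_idem he hf
  have hfe : (f * e) * (f * e) = f * e := mul_idem hf he
  have he1 : ∀ y : S, e * (e * y) = e * y := fun y => by rw [← mul_assoc, he]
  have hf1 : ∀ y : S, f * (f * y) = f * y := fun y => by rw [← mul_assoc, hf]
  have hefn : e * (f * (e * f)) = e * f := by simpa only [mul_assoc] using hef
  have hfen : f * (e * (f * e)) = f * e := by simpa only [mul_assoc] using hfe
  have h1 : (e * f) * (f * e) * (e * f) = e * f := by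
    simp only [mul_assoc, hf1, he1]
    exact hefn
  have h2 : (f * e) * (e * f) * (f * e) = f * e := by
    simp only [mul_assoc, he1, hf1]
    exact hfen
  have := star_unique (e * f) (f * e) h1 h2
  rw [this, star_idem hef]

theorem star_mul (a b : S) : star (a * b) = star b * star a := by
  set u := star a with hu
  set v := star b with hv
  have han : a * (u * a) = a := by simpa only [mul_assoc] using mul_star_mul a
  have hun : u * (a * u) = u := by simpa only [mul_assoc] using star_mul_star a
  have hbn : b * (v * b) = b := by simpa only [mul_assoc] using mul_star_mul b
  have hvn : v * (b * v) = v := by simpa only [mul_assoc] using star_mul_star b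
  have ha1 : ∀ y : S, a * (u * (a * y)) = a * y := fun y => by
    have h := congrArg (· * y) (mul_star_mul a); simpa only [mul_assoc] using h
  have hv1 : ∀ y : S, v * (b * (v * y)) = v * y := fun y => by
    have h := congrArg (· * y) (star_mul_star b); simpa only [mul_assoc] using h
  have hua : (u * a) * (u * a) = u * a := by
    simp only [mul_assoc]; rw [han]
  have hbv : (b * v) * (b * v) = b * v := by
    simp only [mul_assoc]; rw [hvn]
  have hc : (b * v) * (u * a) = (u * a) * (b * v) := idem_comm hbv hua
  have hc1 : ∀ y : S, b * (v * (u * (a * y))) = u * (a * (b * (v * y))) := fun y => by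
    have h := congrArg (· * y) hc; simpa only [mul_assoc] using h
  have goal1 : (a * b) * (v * u) * (a * b) = a * b := by
    simp only [mul_assoc]
    rw [hc1, ha1, hbn]
  have goal2 : (v * u) * (a * b) * (v * u) = v * u := by
    simp only [mul_assoc]
    rw [← hc1, hv1, hun]
  exact ((star_unique (a * b) (v * u) goal1 goal2)).symm

theorem star_mul_self_idem (s : S) : (star s * s) * (star s * s) = star s * s := by
  have h := congrArg (star s * ·) (mul_star_mul s)
  simpa only [mul_assoc] using h

theorem mul_star_self_idem (s : S) : (s * star s) * (s * star s) = s * star s := by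
  have h := congrArg (· * star s) (mul_star_mul s)
  simpa only [mul_assoc] using h

end InverseSemigroup

open InverseSemigroup

/-- The left-cancellative category `L(S)` of an inverse semigroup `S`: objects are
the idempotents, and a morphism `f ⟶ e` is an element `s` with `e * s = s` and
`s* * s = f`; composition is multiplication. -/
def LCat (S : Type u) [InverseSemigroup S] : Type u := {e : S // e * e = e}

namespace LCat

variable {S : Type u} [InverseSemigroup S]

instance : Category.{u} (LCat S) where
  Hom f e := {s : S // e.1 * s = s ∧ star s * s = f.1}
  id e := ⟨e.1, by rw [e.2], by rw [star_idem e.2, e.2]⟩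
  comp := fun {f g e} u v => ⟨v.1 * u.1, by
      constructor
      · rw [← mul_assoc, v.2.1]
      · calc star (v.1 * u.1) * (v.1 * u.1)
            = star u.1 * ((star v.1 * v.1) * u.1) := by
              rw [InverseSemigroup.star_mul]; simp only [mul_assoc]
          _ = star u.1 * (g.1 * u.1) := by rw [v.2.2]
          _ = star u.1 * u.1 := by rw [u.2.1]
          _ = f.1 := u.2.2⟩
  id_comp := fun {f e} u => by
    apply Subtype.ext
    show u.1 * f.1 = u.1
    have h2 := u.2.2
    calc u.1 * f.1 = u.1 * (star u.1 * u.1) := by rw [h2]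
      _ = u.1 := by rw [← mul_assoc, mul_star_mul]
  comp_id := fun {f e} u => by
    apply Subtype.ext
    show e.1 * u.1 = u.1
    exact u.2.1
  assoc := fun u v w => Subtype.ext (mul_assoc w.1 v.1 u.1).symm

end LCat

namespace MoritaAux

open CategoryTheory.Limits Opposite

section FromTopos

variable {S T : Type u} [InverseSemigroup S] [InverseSemigroup T]

theorem LCat.comp_val {a b c : LCat S} (u : a ⟶ b) (v : b ⟶ c) : (u ≫ v).1 = v.1 * u.1 := rfl

theorem LCat.id_val (a : LCat S) : (𝟙 a : a ⟶ a).1 = a.1 := rfl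

theorem LCat.eq_id_of_idem {a : LCat S} (u : a ⟶ a) (h : u ≫ u = u) : u = 𝟙 a := by
  have h1 : u.1 * u.1 = u.1 := congrArg Subtype.val h
  apply Subtype.ext
  have h2 := u.2.2
  rw [star_idem h1, h1] at h2
  exact h2

theorem essImage_of_equivalence (F : ((LCat S)ᵒᵖ ⥤ Type u) ≌ ((LCat T)ᵒᵖ ⥤ Type u)) (e : LCat S) :
    (yoneda (C := LCat T)).essImage (F.functor.obj (yoneda.obj e)) := by
  set P := F.functor.obj (yoneda.obj e) with hP
  let G : ((LCat T)ᵒᵖ ⥤ Type u) ⥤ Type u := F.inverse ⋙ (evaluation _ _).obj (op e)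
  have hc : IsColimit (G.mapCocone (Presheaf.tautologicalCocone P)) :=
    isColimitOfPreserves G (Presheaf.isColimitTautologicalCocone P)
  obtain ⟨f, r, y, hy⟩ : ∃ (f : LCat T) (r : yoneda.obj f ⟶ P)
      (y : (F.inverse.obj (yoneda.obj f)).obj (op e)),
      (F.inverse.map r).app (op e) y = yonedaEquiv (F.unit.app (yoneda.obj e)) := by
    obtain ⟨j, y, hy⟩ := Types.jointly_surjective_of_isColimit hc
      (yonedaEquiv (F.unit.app (yoneda.obj e)))
    exact ⟨j.left, j.hom, y, hy⟩
  have hy' : yonedaEquiv.symm y ≫ F.inverse.map r = F.unit.app (yoneda.obj e) := by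
    apply yonedaEquiv.injective
    rw [yonedaEquiv_comp, Equiv.apply_symm_apply]
    exact hy
  let i : P ⟶ yoneda.obj f := (F.toAdjunction.homEquiv _ _).symm (yonedaEquiv.symm y)
  have hi : i ≫ r = 𝟙 P := by
    apply (F.toAdjunction.homEquiv _ _).injective
    rw [Adjunction.homEquiv_naturality_right, Equiv.apply_symm_apply, Adjunction.homEquiv_unit]
    rw [hy', CategoryTheory.Functor.map_id]
    exact (Category.comp_id _).symm
  have hji : r ≫ i = 𝟙 (yoneda.obj f) := by
    obtain ⟨u, hu⟩ := (yoneda (C := LCat T)).map_surjective (r ≫ i)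
    have : u ≫ u = u := by
      apply (yoneda (C := LCat T)).map_injective
      rw [Functor.map_comp, hu]
      simp only [Category.assoc]
      rw [← Category.assoc i r i, hi, Category.id_comp]
    rw [← hu, LCat.eq_id_of_idem u this, CategoryTheory.Functor.map_id]
  exact ⟨f, ⟨⟨r, i, hji, hi⟩⟩⟩

theorem exists_equivalence (F : ((LCat S)ᵒᵖ ⥤ Type u) ≌ ((LCat T)ᵒᵖ ⥤ Type u)) :
    ∃ K : LCat S ⥤ LCat T, K.IsEquivalence := by
  let y : LCat T ⥤ _ := yoneda
  let G : LCat S ⥤ _ := yoneda ⋙ F.functor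
  have hG : ∀ e, y.essImage (G.obj e) := fun e => essImage_of_equivalence F e
  let K := Functor.essImage.liftFunctor G y hG
  let α : K ⋙ y ≅ G := Functor.essImage.liftFunctorCompIso G y hG
  have : (K ⋙ y).Full := Functor.Full.of_iso α.symm
  have : (K ⋙ y).Faithful := Functor.Faithful.of_iso α.symm
  have h1 : K.Full := Functor.Full.of_comp_faithful K y
  have h2 : K.Faithful := Functor.Faithful.of_comp K y
  have h3 : K.EssSurj := ⟨fun f => by
    obtain ⟨e, ⟨i⟩⟩ := essImage_of_equivalence F.symm f
    refine ⟨e, ⟨y.preimageIso (α.app e ≪≫ F.functor.mapIso i ≪≫ F.counitIso.app _)⟩⟩⟩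
  exact ⟨K, {}⟩

theorem topos_equiv_of_equiv (K : LCat S ≌ LCat T) :
    Nonempty (((LCat S)ᵒᵖ ⥤ Type u) ≌ ((LCat T)ᵒᵖ ⥤ Type u)) :=
  ⟨K.op.congrLeft⟩

end FromTopos

section FromBiset

variable {S T : Type u} [InverseSemigroup S] [InverseSemigroup T]

theorem equiv_of_biset (h : StronglyMoritaEquivalent S T) : Nonempty (LCat S ≌ LCat T) := by
  obtain ⟨X, smul, tmul, inn, brk, hs, ht, hst, hinn, hbrk, M1, M2, M3, M4, M5, M6, M7⟩ := h
  have hii : ∀ x, inn x x * inn x x = inn x x := fun x => by rw [← M1, M3]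
  have hbb : ∀ x, brk x x * brk x x = brk x x := fun x => by rw [← M4, M6]
  have adjS : ∀ s x y, brk (smul s x) y = brk x (smul (star s) y) := by
    intro s x y
    obtain ⟨⟨a, b⟩, rfl⟩ := hinn s
    simp only
    rw [M7, ← M2, M7, M4, M5 (tmul a _) y, M4, InverseSemigroup.star_mul, ← M5, ← M5]
  have inn_surj : ∀ e : S, e * e = e → ∃ x, inn x x = e := by
    intro e he
    obtain ⟨⟨x, y⟩, rfl⟩ := hinn e
    simp only at he ⊢
    have h1 : inn x y * inn y y = inn x y := by
      rw [M2 y x, M2 y y, ← InverseSemigroup.star_mul, ← M1, M3]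
    have h2 : inn (smul (inn x y) y) y = inn x y := by rw [M1, h1]
    refine ⟨smul (inn x y) y, ?_⟩
    rw [M1, M2 _ y, h2, star_idem he, he]
  have brk_surj : ∀ e : T, e * e = e → ∃ x, brk x x = e := by
    intro e he
    obtain ⟨⟨x, y⟩, rfl⟩ := hbrk e
    simp only at he ⊢
    have h1 : brk x x * brk x y = brk x y := by
      rw [M5 x y, M5 x x, ← InverseSemigroup.star_mul, ← M4, M6]
    have h2 : brk x (tmul x (brk x y)) = brk x y := by rw [M4, h1]
    refine ⟨tmul x (brk x y), ?_⟩
    rw [M4, M5 _ x, h2, star_idem he, he]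
  let A : X → LCat S := fun x => ⟨inn x x, hii x⟩
  let B : X → LCat T := fun x => ⟨brk x x, hbb x⟩
  have fix : ∀ {x y : X} (s : A x ⟶ A y), smul (inn y y) (smul s.1 x) = smul s.1 x := by
    intro x y s
    rw [← hs]
    exact congrArg (smul · x) s.2.1
  let G : InducedCategory (LCat S) A ⥤ LCat T :=
    { obj := B
      map := fun {x y} s => ⟨brk y (smul s.hom.1 x), by
        constructor
        · show brk y y * brk y _ = brk y _
          rw [← M4, ← M7, fix]
        · show _ = brk x x
          rw [← M5, ← M4, ← M7, fix, adjS, ← hs]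
          have h2 : star s.hom.1 * s.hom.1 = inn x x := s.hom.2.2
          rw [h2, M3]⟩
      map_id := fun x => by
        apply Subtype.ext
        show brk x (smul (inn x x) x) = brk x x
        rw [M3]
      map_comp := fun {x y z} s s' => by
        apply Subtype.ext
        show brk z (smul (s'.hom.1 * s.hom.1) x) =
          brk z (smul s'.hom.1 y) * brk y (smul s.hom.1 x)
        rw [← M4, hst, ← M7, fix, hs] }
  have G1 : G.Faithful := ⟨by
    intro x y s s' h
    have h' : brk y (smul s.hom.1 x) = brk y (smul s'.hom.1 x) := congrArg Subtype.val h
    have h2 : smul s.hom.1 x = smul s'.hom.1 x := by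
      rw [← fix s.hom, ← fix s'.hom, M7, M7, h']
    have h3 : ∀ s : A x ⟶ A y, s.1 = inn (smul s.1 x) x := by
      intro s
      have h2 : star s.1 * s.1 = inn x x := s.2.2
      rw [M1, ← h2, ← mul_assoc, mul_star_mul]
    apply InducedCategory.hom_ext
    apply Subtype.ext
    rw [h3 s.hom, h3 s'.hom, h2]⟩
  have G2 : G.Full := ⟨by
    intro x y t
    have t1 : brk y y * t.1 = t.1 := t.2.1
    have t2 : star t.1 * t.1 = brk x x := t.2.2
    refine ⟨InducedCategory.homMk ⟨inn (tmul y t.1) x, ?_, ?_⟩, ?_⟩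
    · show inn y y * _ = _
      rw [← M1, M7, M4, t1]
    · show _ = inn x x
      rw [← M2, ← M1, M7, M4, M5 _ y, M4, InverseSemigroup.star_mul, ← M5, mul_assoc, t1, t2, M6]
    · apply Subtype.ext
      show brk y (smul (inn (tmul y t.1) x) x) = t.1
      rw [M7, M4, M4, t1, ← t2, ← mul_assoc, mul_star_mul]⟩
  have G3 : G.EssSurj := ⟨fun f => by
    obtain ⟨x, hx⟩ := brk_surj f.1 f.2
    have : B x = f := Subtype.ext hx
    exact ⟨x, ⟨eqToIso this⟩⟩⟩
  have I3 : (inducedFunctor A).EssSurj := ⟨fun f => by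
    obtain ⟨x, hx⟩ := inn_surj f.1 f.2
    have : A x = f := Subtype.ext hx
    exact ⟨x, ⟨eqToIso this⟩⟩⟩
  have I : (inducedFunctor A).IsEquivalence := {}
  have J : G.IsEquivalence := {}
  exact ⟨(inducedFunctor A).asEquivalence.symm.trans G.asEquivalence⟩

end FromBiset

section ToBiset

variable {S T : Type u} [InverseSemigroup S] [InverseSemigroup T]

theorem conj_absorb {s e x : S} (he : e * e = e) (hx : e * x = x) :
    s * e * star s * (s * x) = s * x := by
  have hc := idem_comm he (star_mul_self_idem s)
  calc s * e * star s * (s * x) = s * (e * (star s * s)) * x := by simp only [mul_assoc]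
    _ = s * star s * s * (e * x) := by rw [hc]; simp only [mul_assoc]
    _ = s * x := by rw [mul_star_mul, hx]

theorem mul_star_of_left {e s : S} (he : e * e = e) (h : e * s = s) : star s * e = star s := by
  have := congrArg InverseSemigroup.star h
  rwa [InverseSemigroup.star_mul, star_idem he] at this

theorem mul_star_of_right {e s : S} (he : e * e = e) (h : s * e = s) : e * star s = star s := by
  have := congrArg InverseSemigroup.star h
  rwa [InverseSemigroup.star_mul, star_idem he] at this

theorem biset_of_karoubi (Φ : S → S → S → T)
    (hΦ : ∀ e f g s s', e * e = e → f * f = f → g * g = g → e * s = s → s * f = s →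
      f * s' = s' → s' * g = s' → Φ e f s * Φ f g s' = Φ e g (s * s'))
    (hinj : ∀ e f s s', e * e = e → f * f = f → e * s = s → s * f = s →
      e * s' = s' → s' * f = s' → Φ e f s = Φ e f s' → s = s')
    (hsurj : ∀ e f t, e * e = e → f * f = f → Φ e e e * t = t → t * Φ f f f = t →
      ∃ s, e * s = s ∧ s * f = s ∧ Φ e f s = t)
    (hess : ∀ f : T, f * f = f → ∃ (e : S) (t : T), e * e = e ∧ t * star t = Φ e e e ∧ star t * t = f) :
    StronglyMoritaEquivalent S T := by
  have hid : ∀ e, e * e = e → Φ e e e * Φ e e e = Φ e e e := fun e he => by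
    rw [hΦ e e e e e he he he he he he he, he]
  have hl : ∀ e f s, e * e = e → f * f = f → e * s = s → s * f = s →
      Φ e e e * Φ e f s = Φ e f s := fun e f s he hf h1 h2 => by
    rw [hΦ e e f e s he he hf he he h1 h2, h1]
  have hr : ∀ e f s, e * e = e → f * f = f → e * s = s → s * f = s →
      Φ e f s * Φ f f f = Φ e f s := fun e f s he hf h1 h2 => by
    rw [hΦ e f f s f he hf hf h1 h2 hf hf, h2]
  have hstar : ∀ e f s, e * e = e → f * f = f → e * s = s → s * f = s →
      star (Φ e f s) = Φ f e (star s) := fun e f s he hf h1 h2 => by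
    have h3 := mul_star_of_left he h1
    have h4 := mul_star_of_right hf h2
    symm
    apply star_unique
    · rw [hΦ e f e _ _ he hf he h1 h2 h4 h3,
        hΦ e e f _ _ he he hf (by rw [← mul_assoc, h1]) (by rw [mul_assoc, h3]) h1 h2, mul_star_mul]
    · rw [hΦ f e f _ _ hf he hf h4 h3 h1 h2,
        hΦ f f e _ _ hf hf he (by rw [← mul_assoc, h4]) (by rw [mul_assoc, h2]) h4 h3,
        InverseSemigroup.star_mul_star]
  let X : Type u := {p : S × T // p.1 * p.1 = p.1 ∧ p.2 * star p.2 = Φ p.1 p.1 p.1}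
  -- basic facts on elements of X
  have hX : ∀ x : X, Φ x.1.1 x.1.1 x.1.1 * x.1.2 = x.1.2 := fun x => by
    rw [← x.2.2, mul_star_mul]
  have hX' : ∀ x : X, star x.1.2 * Φ x.1.1 x.1.1 x.1.1 = star x.1.2 := fun x => by
    rw [← x.2.2, ← mul_assoc, InverseSemigroup.star_mul_star]
  -- extensionality
  have ext : ∀ (e : S) (x y : X), e * e = e → e * x.1.1 = x.1.1 → e * y.1.1 = y.1.1 →
      Φ e x.1.1 x.1.1 * x.1.2 = Φ e y.1.1 y.1.1 * y.1.2 → x = y := by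
    intro e x y he hx hy h
    have key : ∀ x : X, e * x.1.1 = x.1.1 → Φ e e x.1.1 =
        (Φ e x.1.1 x.1.1 * x.1.2) * star (Φ e x.1.1 x.1.1 * x.1.2) := by
      intro x hx
      have hx' : x.1.1 * e = x.1.1 := by rw [idem_comm x.2.1 he, hx]
      rw [InverseSemigroup.star_mul, mul_assoc, ← mul_assoc x.1.2, x.2.2,
        hstar e _ _ he x.2.1 hx x.2.1, star_idem x.2.1,
        hΦ _ _ _ _ _ x.2.1 x.2.1 he x.2.1 x.2.1 x.2.1 hx', x.2.1,
        hΦ _ _ _ _ _ he x.2.1 he hx x.2.1 x.2.1 hx', x.2.1]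
    have key2 : ∀ x : X, e * x.1.1 = x.1.1 → x.1.2 =
        Φ x.1.1 e x.1.1 * (Φ e x.1.1 x.1.1 * x.1.2) := by
      intro x hx
      have hx' : x.1.1 * e = x.1.1 := by rw [idem_comm x.2.1 he, hx]
      rw [← mul_assoc, hΦ _ _ _ _ _ x.2.1 he x.2.1 x.2.1 hx' hx x.2.1, x.2.1, hX]
    have h1 : x.1.1 = y.1.1 := by
      apply hinj e e _ _ he he hx (by rw [idem_comm x.2.1 he, hx]) hy
        (by rw [idem_comm y.2.1 he, hy])
      rw [key x hx, key y hy, h]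
    apply Subtype.ext
    apply Prod.ext h1
    rw [key2 x hx, key2 y hy, h, h1]
  -- left action
  have hconj : ∀ (s : S) (x : X), (s * x.1.1 * star s) * (s * x.1.1 * star s) = s * x.1.1 * star s :=
    fun s x => by
      have := conj_absorb (s := s) (x := x.1.1 * star s) x.2.1 (by rw [← mul_assoc, x.2.1])
      simpa only [mul_assoc] using this
  let smul : S → X → X := fun s x => ⟨(s * x.1.1 * star s,
      Φ (s * x.1.1 * star s) x.1.1 (s * x.1.1) * x.1.2), hconj s x, by
    have h1 : s * x.1.1 * star s * (s * x.1.1) = s * x.1.1 := conj_absorb x.2.1 x.2.1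
    have h2 : s * x.1.1 * x.1.1 = s * x.1.1 := by rw [mul_assoc, x.2.1]
    have h3 := mul_star_of_left (hconj s x) h1
    have h4 := mul_star_of_right x.2.1 h2
    show Φ (s * x.1.1 * star s) x.1.1 (s * x.1.1) * x.1.2 *
      star (Φ (s * x.1.1 * star s) x.1.1 (s * x.1.1) * x.1.2) = Φ _ _ (s * x.1.1 * star s)
    rw [InverseSemigroup.star_mul, mul_assoc, ← mul_assoc x.1.2, x.2.2,
      hstar _ _ _ (hconj s x) x.2.1 h1 h2, hl _ _ _ x.2.1 (hconj s x) h4 h3,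
      hΦ _ _ _ _ _ (hconj s x) x.2.1 (hconj s x) h1 h2 h4 h3, InverseSemigroup.star_mul,
      star_idem x.2.1, ← mul_assoc, h2]⟩
  -- right action
  have hT : ∀ (x : X) (u : T), ∃ z : X, x.1.1 * z.1.1 = z.1.1 ∧
      Φ x.1.1 z.1.1 z.1.1 * z.1.2 = x.1.2 * u := by
    intro x u
    obtain ⟨⟨e, t⟩, he, hx⟩ := x
    simp only at he hx ⊢
    have hF : Φ e e e * t = t := by rw [← hx, mul_star_mul]
    have hF' : star t * Φ e e e = star t := by rw [← hx, ← mul_assoc, InverseSemigroup.star_mul_star]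
    obtain ⟨e', h1, h2, h3⟩ := hsurj e e (t * u * star (t * u)) he he
      (by rw [← mul_assoc, ← mul_assoc, hF])
      (by rw [InverseSemigroup.star_mul, mul_assoc, mul_assoc (star u), hF'])
    have h4 : e' * e' = e' := by
      apply hinj e e _ _ he he (by rw [← mul_assoc, h1]) (by rw [mul_assoc, h2]) h1 h2
      rw [← hΦ e e e e' e' he he he h1 h2 h1 h2, h3, mul_star_self_idem]
    refine ⟨⟨(e', Φ e' e e' * (t * u)), h4, ?_⟩, h1, ?_⟩
    · show Φ e' e e' * (t * u) * star (Φ e' e e' * (t * u)) = Φ e' e' e'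
      rw [InverseSemigroup.star_mul, mul_assoc, ← mul_assoc (t * u), ← h3,
        hstar _ _ _ h4 he h4 h2, star_idem h4, hΦ _ _ _ _ _ he he h4 h1 h2 h1 h4,
        h4, hΦ _ _ _ _ _ h4 he h4 h4 h2 h1 h4, h4]
    · show Φ e e' e' * (Φ e' e e' * (t * u)) = t * u
      rw [← mul_assoc, hΦ _ _ _ _ _ he h4 he h1 h4 h4 h2, h4, h3, mul_star_mul]
  choose tmul tmul1 tmul2 using hT
  have tuniq : ∀ (x : X) (u : T) (z : X), x.1.1 * z.1.1 = z.1.1 →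
      Φ x.1.1 z.1.1 z.1.1 * z.1.2 = x.1.2 * u → tmul x u = z := by
    intro x u z h1 h2
    exact ext x.1.1 _ _ x.2.1 (tmul1 x u) h1 (by rw [tmul2, h2])
  -- inner product
  have hI : ∀ x y : X, ∃ r, x.1.1 * r = r ∧ r * y.1.1 = r ∧
      Φ x.1.1 y.1.1 r = x.1.2 * star y.1.2 := fun x y =>
    hsurj _ _ _ x.2.1 y.2.1 (by rw [← mul_assoc, hX]) (by rw [mul_assoc, hX'])
  choose inn inn1 inn2 inn3 using hI
  have iuniq : ∀ (x y : X) r, x.1.1 * r = r → r * y.1.1 = r →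
      Φ x.1.1 y.1.1 r = x.1.2 * star y.1.2 → inn x y = r := fun x y r h1 h2 h3 =>
    hinj _ _ _ _ x.2.1 y.2.1 (inn1 x y) (inn2 x y) h1 h2 (by rw [inn3, h3])
  have hlm : ∀ x y : X, x.1.1 * (x.1.1 * y.1.1) = x.1.1 * y.1.1 := fun x y => by
    rw [← mul_assoc, x.2.1]
  have hrm : ∀ x y : X, x.1.1 * y.1.1 * y.1.1 = x.1.1 * y.1.1 := fun x y => by
    rw [mul_assoc, y.2.1]
  let brk : X → X → T := fun x y => star x.1.2 * (Φ x.1.1 y.1.1 (x.1.1 * y.1.1) * y.1.2)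
  have innself : ∀ x : X, inn x x = x.1.1 := fun x => iuniq x x _ x.2.1 x.2.1 x.2.2.symm
  have brkself : ∀ x : X, brk x x = star x.1.2 * x.1.2 := fun x => by
    show star x.1.2 * (Φ x.1.1 x.1.1 (x.1.1 * x.1.1) * x.1.2) = _
    rw [x.2.1, hX]
  -- moving left actions
  have smove : ∀ (s : S) (x : X) (g : S), g * g = g → g * (s * x.1.1) = s * x.1.1 →
      Φ g (s * x.1.1 * star s) (s * x.1.1 * star s) *
        (Φ (s * x.1.1 * star s) x.1.1 (s * x.1.1) * x.1.2) = Φ g x.1.1 (s * x.1.1) * x.1.2 := by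
    intro s x g hg h
    rw [← mul_assoc, hΦ _ _ _ _ _ hg (hconj s x) x.2.1 (by rw [← mul_assoc, h]) (hconj s x)
      (conj_absorb x.2.1 x.2.1) (by rw [mul_assoc, x.2.1]), conj_absorb x.2.1 x.2.1]
  refine ⟨X, smul, tmul, inn, brk, ?_, ?_, ?_, ?_, ?_, ?_, ?_, ?_, ?_, ?_, ?_, ?_⟩
  · intro s₁ s₂ x
    have h0 : s₁ * s₂ * x.1.1 * star (s₁ * s₂) = s₁ * (s₂ * x.1.1 * star s₂) * star s₁ := by
      rw [InverseSemigroup.star_mul]; simp only [mul_assoc]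
    have h1 := conj_absorb (s := s₂) x.2.1 x.2.1
    have h2 := hconj s₁ (smul s₂ x)
    have h3 : s₁ * (s₂ * x.1.1 * star s₂) * star s₁ * (s₁ * (s₂ * x.1.1 * star s₂))
      = s₁ * (s₂ * x.1.1 * star s₂) := conj_absorb (hconj s₂ x) (hconj s₂ x)
    apply Subtype.ext
    apply Prod.ext h0
    show Φ (s₁ * s₂ * x.1.1 * star (s₁ * s₂)) x.1.1 (s₁ * s₂ * x.1.1) * x.1.2 =
      Φ (s₁ * (s₂ * x.1.1 * star s₂) * star s₁) (s₂ * x.1.1 * star s₂)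
        (s₁ * (s₂ * x.1.1 * star s₂)) *
        (Φ (s₂ * x.1.1 * star s₂) x.1.1 (s₂ * x.1.1) * x.1.2)
    rw [← mul_assoc (Φ _ _ _), hΦ _ _ _ _ _ h2 (hconj s₂ x) x.2.1 h3
      (by rw [mul_assoc, hconj]) h1 (by rw [mul_assoc, x.2.1]), h0, mul_assoc s₁ _ (s₂ * x.1.1),
      h1, mul_assoc s₁ s₂ x.1.1]
  · intro x t₁ t₂
    symm
    apply tuniq
    · rw [← tmul1 (tmul x t₁) t₂, ← mul_assoc, tmul1 x]
    · have h1 := tmul1 x t₁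
      have h2 := tmul1 (tmul x t₁) t₂
      rw [← mul_assoc, ← tmul2 x t₁, mul_assoc, ← tmul2 (tmul x t₁) t₂, ← mul_assoc,
        hΦ _ _ _ _ _ x.2.1 (tmul x t₁).2.1 (tmul (tmul x t₁) t₂).2.1 h1 (tmul x t₁).2.1 h2
          (tmul (tmul x t₁) t₂).2.1, h2]
  · intro s x t
    apply tuniq
    · show s * x.1.1 * star s * (s * (tmul x t).1.1 * star s) = s * (tmul x t).1.1 * star s
      rw [← mul_assoc, conj_absorb x.2.1 (tmul1 x t)]
    · show Φ (s * x.1.1 * star s) (s * (tmul x t).1.1 * star s) (s * (tmul x t).1.1 * star s) *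
        (Φ (s * (tmul x t).1.1 * star s) (tmul x t).1.1 (s * (tmul x t).1.1) * (tmul x t).1.2)
        = Φ (s * x.1.1 * star s) x.1.1 (s * x.1.1) * x.1.2 * t
      rw [smove s (tmul x t) _ (hconj s x) (conj_absorb x.2.1 (tmul1 x t)), mul_assoc _ x.1.2,
        ← tmul2 x t, ← mul_assoc (Φ _ _ _), hΦ _ _ _ _ _ (hconj s x) x.2.1 (tmul x t).2.1
        (conj_absorb x.2.1 x.2.1) (by rw [mul_assoc, x.2.1]) (tmul1 x t) (tmul x t).2.1,
        mul_assoc s x.1.1 (tmul x t).1.1, tmul1]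
  · intro s
    have h1 : s * star s * s = s := mul_star_mul s
    have h2 : s * (star s * s) = s := by rw [← mul_assoc, h1]
    have i1 := mul_star_self_idem s
    have i2 := star_mul_self_idem s
    have h3 := mul_star_of_left i1 h1
    have h4 := mul_star_of_right i2 h2
    let x : X := ⟨(s * star s, Φ (s * star s) (star s * s) s), i1, by
      simp only
      rw [hstar _ _ _ i1 i2 h1 h2, hΦ _ _ _ _ _ i1 i2 i1 h1 h2 h4 h3]⟩
    let y : X := ⟨(star s * s, Φ (star s * s) (star s * s) (star s * s)), i2, by
      simp only
      rw [star_idem (hid _ i2), hid _ i2]⟩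
    refine ⟨(x, y), iuniq x y s h1 h2 ?_⟩
    show _ = Φ (s * star s) (star s * s) s * star (Φ (star s * s) (star s * s) (star s * s))
    rw [star_idem (hid _ i2), hr _ _ _ i1 i2 h1 h2]
  · intro v
    obtain ⟨e, w, he, h1, h2⟩ := hess (v * star v) (mul_star_self_idem v)
    let x : X := ⟨(e, w), he, h1⟩
    let y : X := ⟨(e, w * v), he, by
      show w * v * star (w * v) = Φ e e e
      rw [InverseSemigroup.star_mul, mul_assoc, ← mul_assoc v, ← h2, ← mul_assoc, ← mul_assoc,
        mul_star_mul, h1]⟩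
    refine ⟨(x, y), ?_⟩
    show star w * (Φ e e (e * e) * (w * v)) = v
    rw [he, ← h1, ← mul_assoc (w * star w), mul_star_mul, ← mul_assoc, h2, mul_star_mul]
  · intro s x y
    apply iuniq
    · exact conj_absorb x.2.1 (inn1 x y)
    · rw [mul_assoc, inn2]
    · show Φ (s * x.1.1 * star s) y.1.1 (s * inn x y) =
        Φ (s * x.1.1 * star s) x.1.1 (s * x.1.1) * x.1.2 * star y.1.2
      rw [mul_assoc _ x.1.2, ← inn3, hΦ _ _ _ _ _ (hconj s x) x.2.1 y.2.1 (conj_absorb x.2.1 x.2.1)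
        (by rw [mul_assoc, x.2.1]) (inn1 x y) (inn2 x y), mul_assoc s x.1.1 (inn x y), inn1]
  · intro x y
    apply iuniq
    · exact mul_star_of_right y.2.1 (inn2 x y)
    · exact mul_star_of_left x.2.1 (inn1 x y)
    · rw [← hstar _ _ _ x.2.1 y.2.1 (inn1 x y) (inn2 x y), inn3, InverseSemigroup.star_mul,
        InverseSemigroup.star_star]
  · intro x
    rw [innself]
    have h : x.1.1 * x.1.1 * star x.1.1 = x.1.1 := by rw [star_idem x.2.1, x.2.1, x.2.1]
    apply Subtype.ext
    apply Prod.ext h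
    show Φ (x.1.1 * x.1.1 * star x.1.1) x.1.1 (x.1.1 * x.1.1) * x.1.2 = x.1.2
    rw [h, x.2.1, hX]
  · intro x y t
    show star x.1.2 * (Φ x.1.1 (tmul y t).1.1 (x.1.1 * (tmul y t).1.1) * (tmul y t).1.2) =
      star x.1.2 * (Φ x.1.1 y.1.1 (x.1.1 * y.1.1) * y.1.2) * t
    rw [mul_assoc, mul_assoc, ← tmul2 y t, ← mul_assoc (Φ x.1.1 y.1.1 _),
      hΦ _ _ _ _ _ x.2.1 y.2.1 (tmul y t).2.1 (hlm x y) (hrm x y) (tmul1 y t) (tmul y t).2.1,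
      mul_assoc x.1.1, tmul1]
  · intro x y
    show star x.1.2 * (Φ x.1.1 y.1.1 (x.1.1 * y.1.1) * y.1.2) =
      star (star y.1.2 * (Φ y.1.1 x.1.1 (y.1.1 * x.1.1) * x.1.2))
    rw [InverseSemigroup.star_mul, InverseSemigroup.star_mul, InverseSemigroup.star_star,
      hstar _ _ _ y.2.1 x.2.1 (hlm y x) (hrm y x), InverseSemigroup.star_mul, star_idem x.2.1,
      star_idem y.2.1, mul_assoc]
  · intro x
    rw [brkself]
    apply tuniq _ _ _ x.2.1
    rw [hX, ← mul_assoc, mul_star_mul]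
  · intro x y z
    symm
    have h0 : x.1.1 * (inn x y * z.1.1) = inn x y * z.1.1 := by rw [← mul_assoc, inn1]
    apply tuniq
    · show x.1.1 * (inn x y * z.1.1 * star (inn x y)) = inn x y * z.1.1 * star (inn x y)
      rw [← mul_assoc, h0]
    · show Φ x.1.1 (inn x y * z.1.1 * star (inn x y)) (inn x y * z.1.1 * star (inn x y)) *
        (Φ (inn x y * z.1.1 * star (inn x y)) z.1.1 (inn x y * z.1.1) * z.1.2) =
        x.1.2 * (star y.1.2 * (Φ y.1.1 z.1.1 (y.1.1 * z.1.1) * z.1.2))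
      rw [smove _ z _ x.2.1 h0, ← mul_assoc, ← inn3, ← mul_assoc (Φ x.1.1 y.1.1 _),
        hΦ _ _ _ _ _ x.2.1 y.2.1 z.2.1 (inn1 x y) (inn2 x y) (hlm y z) (hrm y z),
        ← mul_assoc, inn2]

end ToBiset

section Karoubi

variable {S T : Type u} [InverseSemigroup S] [InverseSemigroup T]

theorem hom_mul_source {a b : LCat S} (u : a ⟶ b) : u.1 * a.1 = u.1 := by
  exact congrArg Subtype.val (Category.id_comp u)

theorem source_mul_star {a b : LCat S} (u : a ⟶ b) : a.1 * star u.1 = star u.1 :=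
  mul_star_of_right a.2 (hom_mul_source u)

theorem iso_inv_val {a b : LCat S} (c : a ≅ b) : c.inv.1 = star c.hom.1 := by
  have h1 : c.inv.1 * c.hom.1 = a.1 := congrArg Subtype.val c.hom_inv_id
  have h2 : c.hom.1 * c.inv.1 = b.1 := congrArg Subtype.val c.inv_hom_id
  apply star_unique
  · rw [h2, c.hom.2.1]
  · rw [h1, c.inv.2.1]

theorem iso_mul_star {a b : LCat S} (c : a ≅ b) : c.hom.1 * star c.hom.1 = b.1 := by
  rw [← iso_inv_val]
  exact congrArg Subtype.val c.inv_hom_id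

/-- If two spans represent the same element, they are isomorphic. -/
theorem span_iso {w w' e f : LCat S} (a : w ⟶ e) (b : w ⟶ f) (a' : w' ⟶ e) (b' : w' ⟶ f)
    (h : a.1 * star b.1 = a'.1 * star b'.1) :
    ∃ c : w ≅ w', c.hom ≫ a' = a ∧ c.hom ≫ b' = b := by
  have aux : ∀ {w : LCat S} (a : w ⟶ e) (b : w ⟶ f),
      star (a.1 * star b.1) * (a.1 * star b.1) = b.1 * star b.1 := by
    intro w a b
    rw [InverseSemigroup.star_mul, InverseSemigroup.star_star, mul_assoc, ← mul_assoc (star a.1),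
      a.2.2, source_mul_star]
  have hb : b.1 * star b.1 = b'.1 * star b'.1 := by rw [← aux a b, ← aux a' b', h]
  have c1 : ∀ {w w' : LCat S} (b : w ⟶ f) (b' : w' ⟶ f), b.1 * star b.1 = b'.1 * star b'.1 →
      star b.1 * b'.1 * (star b'.1 * b.1) = w.1 := by
    intro w w' b b' hb
    rw [mul_assoc, ← mul_assoc b'.1, ← hb, mul_star_mul, b.2.2]
  let mk : ∀ {w w' : LCat S} (b : w ⟶ f) (b' : w' ⟶ f), b.1 * star b.1 = b'.1 * star b'.1 →
      (w ⟶ w') := fun {w w'} b b' hb => ⟨star b'.1 * b.1, by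
        rw [← mul_assoc, source_mul_star], by
        rw [InverseSemigroup.star_mul, InverseSemigroup.star_star, c1 b b' hb]⟩
  refine ⟨⟨mk b b' hb, mk b' b hb.symm, Subtype.ext (c1 b b' hb),
    Subtype.ext (c1 b' b hb.symm)⟩, Subtype.ext ?_, Subtype.ext ?_⟩
  · show a'.1 * (star b'.1 * b.1) = a.1
    rw [← mul_assoc, ← h, mul_assoc, b.2.2, hom_mul_source]
  · show b'.1 * (star b'.1 * b.1) = b.1
    rw [← mul_assoc, ← hb, mul_star_mul]

/-- The image of the canonical pullback of `a` and `b`. -/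
theorem exists_pullback {x y z : LCat S} (a : x ⟶ z) (b : y ⟶ z) :
    ∃ (w : LCat S) (p : w ⟶ x) (q : w ⟶ y), IsPullback p q a b ∧
      p.1 * star q.1 = star a.1 * b.1 := by
  have i1 := mul_star_self_idem a.1
  have i2 := mul_star_self_idem b.1
  have hc := idem_comm i1 i2
  let m : S := star a.1 * b.1
  have hm1 : x.1 * m = m := by
    show x.1 * (star a.1 * b.1) = star a.1 * b.1
    rw [← mul_assoc, source_mul_star]
  have hm2 : m * y.1 = m := by
    show star a.1 * b.1 * y.1 = star a.1 * b.1
    rw [mul_assoc, hom_mul_source]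
  have iw := star_mul_self_idem m
  have hyw : y.1 * (star m * m) = star m * m := by
    rw [← mul_assoc, mul_star_of_right y.2 hm2]
  have hmw : star m * m = star b.1 * (a.1 * star a.1) * b.1 := by
    show star (star a.1 * b.1) * (star a.1 * b.1) = _
    rw [InverseSemigroup.star_mul, InverseSemigroup.star_star]; simp only [mul_assoc]
  let w : LCat S := ⟨star m * m, iw⟩
  let p : w ⟶ x := ⟨m, hm1, rfl⟩
  let q : w ⟶ y := ⟨star m * m, hyw, by rw [star_idem iw, iw]⟩
  have hbw : b.1 * (star m * m) = a.1 * star a.1 * b.1 := by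
    calc b.1 * (star m * m) = (b.1 * star b.1 * (a.1 * star a.1)) * b.1 := by
          rw [hmw]; simp only [mul_assoc]
      _ = a.1 * star a.1 * (b.1 * star b.1 * b.1) := by rw [← hc]; simp only [mul_assoc]
      _ = _ := by rw [mul_star_mul]
  refine ⟨w, p, q, ?_, ?_⟩
  · have comm : p ≫ a = q ≫ b := by
      apply Subtype.ext
      show a.1 * (star a.1 * b.1) = b.1 * (star m * m)
      rw [hbw, mul_assoc]
    have hqmono : ∀ {v : LCat S} (g h : v ⟶ w), g ≫ q = h ≫ q → g = h := by
      intro v g h hgh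
      apply Subtype.ext
      have h1 : w.1 * g.1 = w.1 * h.1 := congrArg Subtype.val hgh
      rw [← g.2.1, h1, h.2.1]
    have hlift : ∀ {v : LCat S} (p' : v ⟶ x) (q' : v ⟶ y), p' ≫ a = q' ≫ b →
        ∃ l : v ⟶ w, l ≫ p = p' ∧ l ≫ q = q' := by
      intro v p' q' h
      have h : a.1 * p'.1 = b.1 * q'.1 := congrArg Subtype.val h
      have h1 : m * q'.1 = p'.1 := by
        show star a.1 * b.1 * q'.1 = p'.1
        rw [mul_assoc, ← h, ← mul_assoc, a.2.2, p'.2.1]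
      have h2 : star m * m * q'.1 = q'.1 := by
        rw [hmw]
        calc star b.1 * (a.1 * star a.1) * b.1 * q'.1
            = star b.1 * (a.1 * star a.1 * (b.1 * q'.1)) := by simp only [mul_assoc]
          _ = star b.1 * (a.1 * star a.1 * a.1 * p'.1) := by rw [← h]; simp only [mul_assoc]
          _ = star b.1 * b.1 * q'.1 := by rw [mul_star_mul, h, mul_assoc]
          _ = q'.1 := by rw [b.2.2, q'.2.1]
      exact ⟨⟨q'.1, h2, q'.2.2⟩, Subtype.ext h1, Subtype.ext h2⟩
    refine ⟨⟨comm⟩, ⟨PullbackCone.IsLimit.mk comm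
      (fun s => (hlift s.fst s.snd s.condition).choose)
      (fun s => (hlift s.fst s.snd s.condition).choose_spec.1)
      (fun s => (hlift s.fst s.snd s.condition).choose_spec.2) ?_⟩⟩
    intro s l h1 h2
    apply hqmono
    rw [h2, (hlift s.fst s.snd s.condition).choose_spec.2]
  · show m * star (star m * m) = star a.1 * b.1
    rw [star_idem iw, ← mul_assoc, mul_star_mul]

theorem pullback_val {w x y z : LCat S} {a : x ⟶ z} {b : y ⟶ z} {p : w ⟶ x} {q : w ⟶ y}
    (h : IsPullback p q a b) : p.1 * star q.1 = star a.1 * b.1 := by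
  obtain ⟨w', p', q', h', hpq⟩ := exists_pullback a b
  let i := h.isoIsPullback _ _ h'
  have e1 : p.1 = p'.1 * i.hom.1 := congrArg Subtype.val (h.isoIsPullback_hom_fst _ _ h').symm
  have e2 : q.1 = q'.1 * i.hom.1 := congrArg Subtype.val (h.isoIsPullback_hom_snd _ _ h').symm
  rw [← hpq, e1, e2, InverseSemigroup.star_mul, mul_assoc, ← mul_assoc i.hom.1, iso_mul_star,
    source_mul_star]

variable (K : LCat S ⥤ LCat T)

/-- The element of `T` represented by the image of a span. -/
def theta {w e f : LCat S} (a : w ⟶ e) (b : w ⟶ f) : T := (K.map a).1 * star (K.map b).1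

theorem theta_eq {w w' e f : LCat S} (a : w ⟶ e) (b : w ⟶ f) (a' : w' ⟶ e) (b' : w' ⟶ f)
    (h : a.1 * star b.1 = a'.1 * star b'.1) : theta K a b = theta K a' b' := by
  obtain ⟨c, rfl, rfl⟩ := span_iso a b a' b' h
  have hc : (K.map c.hom).1 * star (K.map c.hom).1 = (K.obj w').1 := iso_mul_star (K.mapIso c)
  unfold theta
  rw [K.map_comp, K.map_comp, LCat.comp_val, LCat.comp_val, InverseSemigroup.star_mul, mul_assoc,
    ← mul_assoc (K.map c.hom).1, hc, source_mul_star]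

/-- The source idempotent of an element. -/
def srcObj (s : S) : LCat S := ⟨star s * s, star_mul_self_idem s⟩

/-- The span `e ← s*s → f` of an element `s` of `e S f`: left leg. -/
def legL (e : LCat S) (s : S) (h : e.1 * s = s) :
    srcObj s ⟶ e := ⟨s, h, rfl⟩

/-- The span `e ← s*s → f` of an element `s` of `e S f`: right leg. -/
def legR (f : LCat S) (s : S) (h : s * f.1 = s) :
    srcObj s ⟶ f :=
  ⟨star s * s, by rw [← mul_assoc, mul_star_of_right f.2 h], by
    rw [star_idem (star_mul_self_idem s), star_mul_self_idem s]; rfl⟩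

theorem leg_val (e f : LCat S) (s : S) (h : e.1 * s = s) (h' : s * f.1 = s) :
    (legL e s h).1 * star (legR f s h').1 = s := by
  show s * star (star s * s) = s
  rw [star_idem (star_mul_self_idem s), ← mul_assoc, mul_star_mul]

open Classical in
/-- Extension of an equivalence to the Karoubi envelopes. -/
noncomputable def PhiK (e f s : S) : T :=
  if h : e * e = e ∧ f * f = f ∧ e * s = s ∧ s * f = s then
    theta K (legL ⟨e, h.1⟩ s h.2.2.1) (legR ⟨f, h.2.1⟩ s h.2.2.2)
  else (K.obj (srcObj s)).1

theorem PhiK_leg (e f : LCat S) (s : S) (h : e.1 * s = s) (h' : s * f.1 = s) :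
    PhiK K e.1 f.1 s = theta K (legL e s h) (legR f s h') :=
  dif_pos ⟨e.2, f.2, h, h'⟩

theorem span_mem_left {w e f : LCat S} (a : w ⟶ e) (b : w ⟶ f) :
    e.1 * (a.1 * star b.1) = a.1 * star b.1 := by rw [← mul_assoc, a.2.1]

theorem span_mem_right {w e f : LCat S} (a : w ⟶ e) (b : w ⟶ f) :
    a.1 * star b.1 * f.1 = a.1 * star b.1 := by rw [mul_assoc, mul_star_of_left f.2 b.2.1]

theorem PhiK_span {w e f : LCat S} (a : w ⟶ e) (b : w ⟶ f) :
    PhiK K e.1 f.1 (a.1 * star b.1) = theta K a b := by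
  rw [PhiK_leg K e f _ (span_mem_left a b) (span_mem_right a b)]
  apply theta_eq
  rw [leg_val]

theorem PhiK_id (e : LCat S) : PhiK K e.1 e.1 e.1 = (K.obj e).1 := by
  have h := PhiK_span K (𝟙 e) (𝟙 e)
  have h1 : (𝟙 e : e ⟶ e).1 * star (𝟙 e : e ⟶ e).1 = e.1 := by
    rw [LCat.id_val, star_idem e.2, e.2]
  rw [h1] at h
  rw [h]
  unfold theta
  rw [K.map_id, LCat.id_val, star_idem (K.obj e).2, (K.obj e).2]

variable [K.IsEquivalence]

theorem PhiK_mul (e f g : LCat S) (s s' : S) (h1 : e.1 * s = s) (h2 : s * f.1 = s)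
    (h3 : f.1 * s' = s') (h4 : s' * g.1 = s') :
    PhiK K e.1 f.1 s * PhiK K f.1 g.1 s' = PhiK K e.1 g.1 (s * s') := by
  obtain ⟨w, p, q, hpb, -⟩ := exists_pullback (legR f s h2) (legL f s' h3)
  have e1 := pullback_val (hpb.map K)
  have e2 := pullback_val hpb
  have e3 : s * s' = (p ≫ legL e s h1).1 * star (q ≫ legR g s' h4).1 := by
    rw [LCat.comp_val, LCat.comp_val, InverseSemigroup.star_mul, mul_assoc, ← mul_assoc p.1, e2]
    calc s * s' = (legL e s h1).1 * star (legR f s h2).1 *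
          ((legL f s' h3).1 * star (legR g s' h4).1) := by rw [leg_val, leg_val]
      _ = _ := by simp only [mul_assoc]
  rw [PhiK_leg K e f s h1 h2, PhiK_leg K f g s' h3 h4, e3, PhiK_span]
  unfold theta
  rw [K.map_comp, K.map_comp, LCat.comp_val, LCat.comp_val, InverseSemigroup.star_mul,
    mul_assoc (K.map (legL e s h1)).1 (K.map p).1, ← mul_assoc (K.map p).1, e1]
  simp only [mul_assoc]

theorem factor {w w' f : LCat S} (a : w ⟶ f) (b : w' ⟶ f)
    (h : (K.map b).1 * star (K.map b).1 * (K.map a).1 = (K.map a).1) :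
    ∃ c : w ⟶ w', c ≫ b = a := by
  let d : K.obj w ⟶ K.obj w' := ⟨star (K.map b).1 * (K.map a).1, by
    rw [← mul_assoc, source_mul_star], by
    rw [InverseSemigroup.star_mul, InverseSemigroup.star_star, mul_assoc,
      ← mul_assoc (K.map b).1, h, (K.map a).2.2]⟩
  obtain ⟨c, hc⟩ := K.map_surjective d
  refine ⟨c, K.map_injective ?_⟩
  rw [K.map_comp, hc]
  apply Subtype.ext
  show (K.map b).1 * (star (K.map b).1 * (K.map a).1) = _
  rw [← mul_assoc, h]

theorem PhiK_inj (e f : LCat S) (s s' : S) (h1 : e.1 * s = s) (h2 : s * f.1 = s)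
    (h3 : e.1 * s' = s') (h4 : s' * f.1 = s') (h : PhiK K e.1 f.1 s = PhiK K e.1 f.1 s') :
    s = s' := by
  rw [PhiK_leg K e f s h1 h2, PhiK_leg K e f s' h3 h4] at h
  have aux : ∀ {w : LCat S} (a : w ⟶ e) (b : w ⟶ f), star (theta K a b) * theta K a b =
      (K.map b).1 * star (K.map b).1 := by
    intro w a b
    unfold theta
    rw [InverseSemigroup.star_mul, InverseSemigroup.star_star, mul_assoc,
      ← mul_assoc (star (K.map a).1), (K.map a).2.2, source_mul_star]
  have hb : (K.map (legR f s h2)).1 * star (K.map (legR f s h2)).1 =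
      (K.map (legR f s' h4)).1 * star (K.map (legR f s' h4)).1 := by
    rw [← aux (legL e s h1), ← aux (legL e s' h3), h]
  have absorb : ∀ (s s' : S) (h2 : s * f.1 = s) (h4 : s' * f.1 = s'),
      (K.map (legR f s h2)).1 * star (K.map (legR f s h2)).1 =
      (K.map (legR f s' h4)).1 * star (K.map (legR f s' h4)).1 →
      ∃ c : S, star s' * s' * c = star s * s := by
    intro s s' h2 h4 hb
    obtain ⟨c, hc⟩ := factor K (legR f s h2) (legR f s' h4) (by rw [← hb, mul_star_mul])
    exact ⟨c.1, congrArg Subtype.val hc⟩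
  have hss : star s * s = star s' * s' := by
    obtain ⟨c, hc⟩ := absorb s s' h2 h4 hb
    obtain ⟨d, hd⟩ := absorb s' s h4 h2 hb.symm
    have k1 : star s' * s' * (star s * s) = star s * s := by
      rw [← hc, ← mul_assoc, star_mul_self_idem]
    have k2 : star s * s * (star s' * s') = star s' * s' := by
      rw [← hd, ← mul_assoc, star_mul_self_idem]
    rw [← k1, idem_comm (star_mul_self_idem _) (star_mul_self_idem _), k2]
  -- replace the second span by one with the same apex
  let w : LCat S := srcObj s
  let a : w ⟶ e := legL e s h1
  let b : w ⟶ f := legR f s h2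
  let a' : w ⟶ e := ⟨s', h3, hss.symm⟩
  have hth : theta K (legL e s' h3) (legR f s' h4) = theta K a' b := by
    apply theta_eq
    rw [leg_val]
    show s' = s' * star (star s * s)
    rw [hss, star_idem (star_mul_self_idem s'), ← mul_assoc, mul_star_mul]
  have hab : theta K a b = theta K a' b := h.trans hth
  have hK : K.map a = K.map a' := by
    apply Subtype.ext
    have := congrArg (· * (K.map b).1) hab
    unfold theta at this
    simp only [mul_assoc, (K.map b).2.2, hom_mul_source] at this
    exact this
  exact congrArg Subtype.val (K.map_injective hK)

theorem PhiK_surj (e f : LCat S) (t : T) (h1 : (K.obj e).1 * t = t) (h2 : t * (K.obj f).1 = t) :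
    ∃ s, e.1 * s = s ∧ s * f.1 = s ∧ PhiK K e.1 f.1 s = t := by
  let g : LCat T := srcObj t
  let w := K.objPreimage g
  let c : K.obj w ≅ g := K.objObjPreimageIso g
  obtain ⟨a, ha⟩ := K.map_surjective (c.hom ≫ legL (K.obj e) t h1)
  obtain ⟨b, hb⟩ := K.map_surjective (c.hom ≫ legR (K.obj f) t h2)
  refine ⟨a.1 * star b.1, span_mem_left a b, span_mem_right a b, ?_⟩
  rw [PhiK_span]
  unfold theta
  rw [ha, hb, LCat.comp_val, LCat.comp_val, InverseSemigroup.star_mul, mul_assoc,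
    ← mul_assoc c.hom.1, iso_mul_star, source_mul_star, leg_val]

theorem PhiK_ess (f : T) (hf : f * f = f) :
    ∃ (e : S) (t : T), e * e = e ∧ t * star t = PhiK K e e e ∧ star t * t = f := by
  let g : LCat T := ⟨f, hf⟩
  let w := K.objPreimage g
  let c : K.obj w ≅ g := K.objObjPreimageIso g
  refine ⟨w.1, star c.hom.1, w.2, ?_, ?_⟩
  · rw [PhiK_id, InverseSemigroup.star_star, c.hom.2.2]
  · rw [InverseSemigroup.star_star, iso_mul_star]

theorem biset_of_equivalence (K : LCat S ⥤ LCat T) [K.IsEquivalence] : StronglyMoritaEquivalent S T := by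
  refine biset_of_karoubi (PhiK K) ?_ ?_ ?_ (PhiK_ess K)
  · intro e f g s s' he hf hg h1 h2 h3 h4
    exact PhiK_mul K ⟨e, he⟩ ⟨f, hf⟩ ⟨g, hg⟩ s s' h1 h2 h3 h4
  · intro e f s s' he hf h1 h2 h3 h4 h
    exact PhiK_inj K ⟨e, he⟩ ⟨f, hf⟩ s s' h1 h2 h3 h4 h
  · intro e f t he hf h1 h2
    have h1' := PhiK_id K ⟨e, he⟩
    have h2' := PhiK_id K ⟨f, hf⟩
    simp only at h1' h2'
    rw [h1'] at h1
    rw [h2'] at h2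
    exact PhiK_surj K ⟨e, he⟩ ⟨f, hf⟩ t h1 h2

end Karoubi

end MoritaAux

/-- Two inverse semigroups are strongly Morita equivalent if and only if they are
topos Morita equivalent, i.e. the presheaf categories on `L(S)` and `L(T)`
(their classifying toposes) are equivalent. -/
theorem stronglyMoritaEquivalent_iff_classifying_topos_equivalence
    (S T : Type u) [InverseSemigroup S] [InverseSemigroup T] :
    StronglyMoritaEquivalent S T ↔
      Nonempty (((LCat S)ᵒᵖ ⥤ Type u) ≌ ((LCat T)ᵒᵖ ⥤ Type u)) := by
  constructor
  · intro h
    obtain ⟨K⟩ := MoritaAux.equiv_of_biset h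
    exact MoritaAux.topos_equiv_of_equiv K
  · rintro ⟨F⟩
    obtain ⟨K, hK⟩ := MoritaAux.exists_equivalence F
    exact MoritaAux.biset_of_equivalence K
end

section
/- Let S and T be semigroups with right local units. Then the category of closed right S-sets is equivalent to the category of closed right T-sets if and only if there is a Morita context for the Cauchy completions C(S) and C(T). -/
universe u

open CategoryTheory

theorem idem_left_absorb {S : Type u} [Semigroup S] {e f s : S}
    (he : e * e = e) (h : e * s * f = s) : e * s = s := by
  conv_lhs => rw [← h]
  rw [← mul_assoc, ← mul_assoc, he]
  exact h

theorem idem_right_absorb {S : Type u} [Semigroup S] {e f s : S}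
    (hf : f * f = f) (h : e * s * f = s) : s * f = s := by
  conv_lhs => rw [← h]
  rw [mul_assoc, hf]
  exact h

/-- The Cauchy completion `C(S)` of a semigroup `S`: objects are the idempotents,
and a morphism `f ⟶ e` is an element `s` with `e * s * f = s`; composition is
multiplication. -/
def CauchyCat (S : Type u) [Semigroup S] : Type u := {e : S // e * e = e}

namespace CauchyCat

variable {S : Type u} [Semigroup S]

instance : Category.{u} (CauchyCat S) where
  Hom f e := {s : S // e.1 * s * f.1 = s}
  id e := ⟨e.1, by rw [e.2, e.2]⟩
  comp := fun {f g e} u v => ⟨v.1 * u.1, by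
    rw [← mul_assoc, idem_left_absorb e.2 v.2, mul_assoc, idem_right_absorb f.2 u.2]⟩
  id_comp := fun {f e} u => Subtype.ext (idem_right_absorb f.2 u.2)
  comp_id := fun {f e} u => Subtype.ext (idem_left_absorb e.2 u.2)
  assoc := fun u v w => Subtype.ext (mul_assoc w.1 v.1 u.1).symm

end CauchyCat

namespace RSet

variable {S : Type u} [Semigroup S]

/-- The base relation defining the tensor product `X ⊗_S S`:
`(x • s, t) ∼ (x, s * t)`. -/
def TensorRel (X : RSet S) : (X.carrier × S) → (X.carrier × S) → Prop :=
  fun a b => ∃ (x : X.carrier) (s t : S), a = (X.act x s, t) ∧ b = (x, s * t)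

/-- The tensor product `X ⊗_S S`. -/
def Tensor (X : RSet S) : Type u := Quot (TensorRel X)

/-- The canonical map `X ⊗_S S → X`, `x ⊗ s ↦ x • s`. -/
def tensorMap (X : RSet S) : X.Tensor → X.carrier :=
  Quot.lift (fun p => X.act p.1 p.2) (by
    rintro a b ⟨x, s, t, rfl, rfl⟩
    exact X.act_mul x s t)

/-- A right `S`-set is closed if the canonical map `X ⊗_S S → X` is bijective. -/
def Closed (X : RSet S) : Prop := Function.Bijective X.tensorMap

end RSet

/-- The category of closed right `S`-sets, with `S`-equivariant maps. -/
abbrev CSet (S : Type u) [Semigroup S] := {X : RSet S // X.Closed}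

/-- A Morita context for categories `A` and `B`: a category `U` together with
weak equivalences (i.e. fully faithful and essentially surjective functors)
from `A` and from `B` to `U`. -/
def MoritaContext (A : Type u) [Category.{u} A] (B : Type u) [Category.{u} B] : Prop :=
  ∃ (U : Type u) (instU : Category.{u} U) (F : @Functor A _ U instU)
    (G : @Functor B _ U instU),
    F.Full ∧ F.Faithful ∧ F.EssSurj ∧ G.Full ∧ G.Faithful ∧ G.EssSurj


/-- Jointly epimorphic families. -/
def JointlyEpi {C : Type*} [Category* C] {J : Type*} {Y : C} (X : J → C)
    (f : ∀ i, X i ⟶ Y) : Prop :=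
  ∀ (Z : C) (g h : Y ⟶ Z), (∀ i, f i ≫ g = f i ≫ h) → g = h

/-- Objects which lift against every small jointly epimorphic family. -/
def AtomicObj {C : Type*} [Category* C] (P : C) : Prop :=
  ∀ (J : Type u) (Y : C) (X : J → C) (f : ∀ i, X i ⟶ Y), JointlyEpi X f →
    ∀ g : P ⟶ Y, ∃ (i : J) (h : P ⟶ X i), h ≫ f i = g

theorem atomicObj_equiv {C D : Type*} [Category* C] [Category* D] (E : C ≌ D) {P : C}
    (hP : AtomicObj.{u} P) : AtomicObj.{u} (E.functor.obj P) := by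
  intro J Y X f hf g
  obtain ⟨i, h, hh⟩ := hP J (E.inverse.obj Y) (fun i => E.inverse.obj (X i))
    (fun i => E.inverse.map (f i)) (by
      intro Z a b hab
      have := hf (E.functor.obj Z) (E.counitInv.app Y ≫ E.functor.map a)
        (E.counitInv.app Y ≫ E.functor.map b) (fun i => by
          have hn := E.counitInv.naturality (f i)
          dsimp at hn
          rw [reassoc_of% hn, reassoc_of% hn, ← Functor.map_comp, ← Functor.map_comp, hab])
      exact E.functor.map_injective ((cancel_epi _).1 this)) (E.unit.app P ≫ E.inverse.map g)
  refine ⟨i, E.functor.map h ≫ E.counit.app _, ?_⟩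
  have := congrArg (fun k => E.functor.map k ≫ E.counit.app _) hh
  simpa using this

theorem jointlyEpi_presheaf {A : Type u} [Category.{u} A] {J : Type u} {Y : Aᵒᵖ ⥤ Type u}
    (X : J → Aᵒᵖ ⥤ Type u) (f : ∀ i, X i ⟶ Y) (hf : JointlyEpi X f) (a : Aᵒᵖ) (y : Y.obj a) :
    ∃ (i : J) (x : (X i).obj a), (f i).app a x = y := by
  let G : Subfunctor Y := ⨆ i, Subfunctor.range (f i)
  have hepi : Epi G.ι := ⟨fun {Z} g h hgh => hf Z g h (fun i => by
    have hle : Subfunctor.range (f i) ≤ G := le_iSup (fun i => Subfunctor.range (f i)) i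
    rw [← Subfunctor.lift_ι (f i) hle, Category.assoc, Category.assoc, hgh])⟩
  have hs : Function.Surjective (G.ι.app a) := (epi_iff_surjective _).1 inferInstance
  obtain ⟨⟨y', hy'⟩, rfl⟩ := hs y
  simpa [G] using hy'

theorem atomicObj_yoneda {A : Type u} [Category.{u} A] (a : A) :
    AtomicObj.{u} (yoneda.obj a) := by
  intro J Y X f hf g
  obtain ⟨i, x, hx⟩ := jointlyEpi_presheaf X f hf (Opposite.op a) (yonedaEquiv g)
  refine ⟨i, yonedaEquiv.symm x, ?_⟩
  apply yonedaEquiv.injective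
  rw [yonedaEquiv_comp, Equiv.apply_symm_apply, hx]

theorem jointlyEpi_yoneda {A : Type u} [Category.{u} A] (P : Aᵒᵖ ⥤ Type u) :
    JointlyEpi (J := Σ a : A, P.obj (Opposite.op a)) (fun p => yoneda.obj p.1)
      (fun p => yonedaEquiv.symm p.2) := by
  intro Z g h hgh
  ext a p
  have := congrArg yonedaEquiv (hgh ⟨a.unop, p⟩)
  rw [yonedaEquiv_comp, yonedaEquiv_comp, Equiv.apply_symm_apply] at this
  exact this

theorem atomicObj_representable {A : Type u} [Category.{u} A] [IsIdempotentComplete A]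
    (P : Aᵒᵖ ⥤ Type u) (hP : AtomicObj.{u} P) : yoneda.essImage P := by
  obtain ⟨⟨a, p⟩, i, hi⟩ := hP _ _ _ _ (jointlyEpi_yoneda P) (𝟙 P)
  generalize yonedaEquiv.symm p = r at hi
  dsimp only at i r hi
  obtain ⟨q, hq⟩ := yoneda.map_surjective (r ≫ i)
  obtain ⟨b, j, e, h1, h2⟩ := IsIdempotentComplete.idempotents_split a q (yoneda.map_injective (by
    rw [Functor.map_comp, hq, Category.assoc, reassoc_of% hi]))
  have h1' : yoneda.map j ≫ yoneda.map e = 𝟙 _ := by rw [← Functor.map_comp, h1, CategoryTheory.Functor.map_id]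
  have h2' : yoneda.map e ≫ yoneda.map j = r ≫ i := by rw [← Functor.map_comp, h2, hq]
  refine ⟨b, ⟨⟨yoneda.map j ≫ r, i ≫ yoneda.map e, ?_, ?_⟩⟩⟩
  · rw [Category.assoc, ← Category.assoc r, ← h2', Category.assoc, h1', Category.comp_id, h1']
  · rw [Category.assoc, ← Category.assoc (yoneda.map e), h2', Category.assoc, hi, Category.comp_id, hi]

theorem moritaContext_of_presheaf_equiv {A B : Type u} [Category.{u} A] [Category.{u} B]
    [IsIdempotentComplete A] [IsIdempotentComplete B]
    (E : (Aᵒᵖ ⥤ Type u) ≌ (Bᵒᵖ ⥤ Type u)) : MoritaContext A B := by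
  have hG : ∀ a, yoneda.essImage ((yoneda ⋙ E.functor).obj a) := fun a =>
    atomicObj_representable _ (atomicObj_equiv E (atomicObj_yoneda a))
  let F : A ⥤ B := Functor.essImage.liftFunctor (yoneda ⋙ E.functor) yoneda hG
  let φ : F ⋙ yoneda ≅ yoneda ⋙ E.functor :=
    Functor.essImage.liftFunctorCompIso (yoneda ⋙ E.functor) yoneda hG
  have ff : (F ⋙ yoneda).FullyFaithful :=
    (Functor.FullyFaithful.ofFullyFaithful (yoneda ⋙ E.functor)).ofIso φ.symm
  have : (F ⋙ yoneda).Full := ff.full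
  have : (F ⋙ yoneda).Faithful := ff.faithful
  refine ⟨B, inferInstance, F, 𝟭 B, Functor.Full.of_comp_faithful F yoneda,
    Functor.Faithful.of_comp F yoneda, ⟨fun b => ?_⟩, inferInstance, inferInstance, inferInstance⟩
  obtain ⟨a, ⟨k⟩⟩ := atomicObj_representable _ (atomicObj_equiv E.symm (atomicObj_yoneda b))
  exact ⟨a, ⟨yoneda.preimageIso (φ.app a ≪≫ E.functor.mapIso k ≪≫ E.counitIso.app _)⟩⟩

instance cauchy_idem (S : Type u) [Semigroup S] : IsIdempotentComplete (CauchyCat S) where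
  idempotents_split X p hp := by
    have hp' : p.1 * p.1 = p.1 := congrArg Subtype.val hp
    have hl := idem_left_absorb X.2 p.2
    have hr := idem_right_absorb X.2 p.2
    refine ⟨⟨p.1, hp'⟩, ⟨p.1, ?_⟩, ⟨p.1, ?_⟩, ?_, ?_⟩
    · change X.1 * p.1 * p.1 = p.1
      rw [hl, hp']
    · change p.1 * p.1 * X.1 = p.1
      rw [hp', hr]
    · exact Subtype.ext hp'
    · exact Subtype.ext hp'

namespace RSet

variable {S : Type u} [Semigroup S]

/-- The presheaf of fixed points. -/
def fixFunctor (S : Type u) [Semigroup S] : CSet S ⥤ ((CauchyCat S)ᵒᵖ ⥤ Type u) where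
  obj X :=
    { obj := fun e => {x : X.1.carrier // X.1.act x e.unop.1 = x}
      map := fun {e f} m => TypeCat.ofHom fun x => ⟨X.1.act x.1 m.unop.1, by
        rw [X.1.act_mul, idem_right_absorb f.unop.2 m.unop.2]⟩
      map_id := fun e => by
        ext x
        exact x.2
      map_comp := fun m n => by
        ext x
        exact (X.1.act_mul _ _ _).symm }
  map g :=
    { app := fun e => TypeCat.ofHom fun x => ⟨g.toFun x.1, by rw [← g.map_act, x.2]⟩
      naturality := fun e f m => by
        ext x
        exact g.map_act _ _ }
  map_id X := rfl
  map_comp g h := rfl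

theorem exists_fix (hS : ∀ s : S, ∃ e : S, e * e = e ∧ s * e = s) (X : CSet S)
    (x : X.1.carrier) : ∃ e : CauchyCat S, X.1.act x e.1 = x := by
  obtain ⟨q, rfl⟩ := X.2.2 x
  obtain ⟨⟨y, s⟩, rfl⟩ := Quot.exists_rep q
  obtain ⟨e, he, hse⟩ := hS s
  refine ⟨⟨e, he⟩, ?_⟩
  change X.1.act (X.1.act y s) e = X.1.act y s
  rw [X.1.act_mul, hse]

theorem fix_faithful (hS : ∀ s : S, ∃ e : S, e * e = e ∧ s * e = s) :
    (fixFunctor S).Faithful where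
  map_injective := by
    intro X Y g h hgh
    apply RSet.Hom.ext
    funext x
    obtain ⟨e, he⟩ := exists_fix hS X x
    have := congrArg (fun k => (k.app (Opposite.op e)) ⟨x, he⟩) hgh
    exact congrArg Subtype.val this

theorem fix_full (hS : ∀ s : S, ∃ e : S, e * e = e ∧ s * e = s) :
    (fixFunctor S).Full where
  map_surjective := by
    intro X Y φ
    -- the value of `φ` at an element fixed by `e`
    let v : ∀ (e : CauchyCat S) (x : X.1.carrier), X.1.act x e.1 = x → Y.1.carrier :=
      fun e x h => (φ.app (Opposite.op e) ⟨x, h⟩).1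
    have vcongr : ∀ e x x' h h', x = x' → v e x h = v e x' h' := by
      rintro e x x' h h' rfl
      rfl
    have vfix : ∀ e x h, Y.1.act (v e x h) e.1 = v e x h := fun e x h =>
      (φ.app (Opposite.op e) ⟨x, h⟩).2
    have vnat : ∀ (e f : CauchyCat S) (m : f ⟶ e) x h h',
        v f (X.1.act x m.1) h' = Y.1.act (v e x h) m.1 := fun e f m x h h' =>
      congrArg Subtype.val (NatTrans.naturality_apply φ m.op ⟨x, h⟩)
    -- naturality for arbitrary elements
    have vnat' : ∀ (g e : CauchyCat S) (x : X.1.carrier) (s : S) hg (_ : s * e.1 = s) h',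
        v e (X.1.act x s) h' = Y.1.act (v g x hg) s := by
      intro g e x s hg hs h'
      have hm : g.1 * (g.1 * s) * e.1 = g.1 * s := by
        rw [mul_assoc, mul_assoc, hs, ← mul_assoc, g.2]
      have e1 : X.1.act x (g.1 * s) = X.1.act x s := by rw [← X.1.act_mul, hg]
      have := vnat g e ⟨g.1 * s, hm⟩ x hg (by rw [e1]; exact h')
      rw [vcongr e _ _ h' (by rw [e1]; exact h') e1.symm]
      refine this.trans ?_
      change Y.1.act (v g x hg) (g.1 * s) = _
      rw [← Y.1.act_mul, vfix]
    choose g hg using exists_fix hS X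
    let w : X.1.carrier → S → Y.1.carrier := fun x s => Y.1.act (v (g x) x (hg x)) s
    have wv : ∀ x s (e : CauchyCat S) (_ : s * e.1 = s) h', w x s = v e (X.1.act x s) h' :=
      fun x s e hs h' => (vnat' (g x) e x s (hg x) hs h').symm
    have hw : ∀ x s t, w (X.1.act x s) t = w x (s * t) := by
      intro x s t
      obtain ⟨e, he, hte⟩ := hS t
      rw [wv _ t ⟨e, he⟩ hte (by rw [X.1.act_mul, hte]),
        wv x (s * t) ⟨e, he⟩ (by rw [mul_assoc, hte]) (by rw [X.1.act_mul, mul_assoc, hte])]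
      exact vcongr _ _ _ _ _ (X.1.act_mul _ _ _)
    let W : X.1.Tensor → Y.1.carrier := Quot.lift (fun p => w p.1 p.2) (by
      rintro a b ⟨x, s, t, rfl, rfl⟩
      exact hw x s t)
    let E := Equiv.ofBijective _ X.2
    have hE : ∀ x s, E.symm (X.1.act x s) = Quot.mk _ (x, s) := fun x s =>
      (Equiv.symm_apply_eq E).2 rfl
    have hWE : ∀ x s, W (E.symm (X.1.act x s)) = w x s := fun x s => by rw [hE]
    refine ⟨⟨fun x => W (E.symm x), ?_⟩, ?_⟩
    · intro x s
      obtain ⟨q, rfl⟩ := X.2.2 x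
      obtain ⟨⟨y, t⟩, rfl⟩ := Quot.exists_rep q
      change W (E.symm (X.1.act (X.1.act y t) s)) = Y.1.act (W (E.symm (X.1.act y t))) s
      rw [X.1.act_mul, hWE, hWE]
      exact (Y.1.act_mul _ _ _).symm
    · ext e x
      apply Subtype.ext
      change W (E.symm x.1) = v e.unop x.1 x.2
      have := hWE x.1 e.unop.1
      rw [x.2] at this
      rw [this, wv x.1 e.unop.1 e.unop e.unop.2 (by rw [x.2, x.2])]
      exact vcongr _ _ _ _ _ x.2

section EssSurj

variable (P : (CauchyCat S)ᵒᵖ ⥤ Type u)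

/-- Generators of the coend. -/
def Pre : Type u := Σ e : CauchyCat S, P.obj (Opposite.op e) × {s : S // e.1 * s = s}

/-- Left multiplication. -/
def lmul {f e : CauchyCat S} (m : f ⟶ e) (s : {s : S // f.1 * s = s}) : {s : S // e.1 * s = s} :=
  ⟨m.1 * s.1, by rw [← mul_assoc, idem_left_absorb e.2 m.2]⟩

/-- Relations of the coend. -/
def PreRel (a b : Pre P) : Prop :=
  ∃ (f e : CauchyCat S) (m : f ⟶ e) (p : P.obj (Opposite.op e)) (s : {s : S // f.1 * s = s}),
    a = ⟨f, P.map m.op p, s⟩ ∧ b = ⟨e, p, lmul m s⟩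

/-- Right multiplication. -/
def rmul {e : CauchyCat S} (s : {s : S // e.1 * s = s}) (t : S) : {s : S // e.1 * s = s} :=
  ⟨s.1 * t, by rw [← mul_assoc, s.2]⟩

/-- The element `p ⊗ s`. -/
def tmk (e : CauchyCat S) (p : P.obj (Opposite.op e)) (s : {s : S // e.1 * s = s}) :
    Quot (PreRel P) := Quot.mk _ ⟨e, p, s⟩

theorem tmk_rel {f e : CauchyCat S} (m : f ⟶ e) (p : P.obj (Opposite.op e))
    (s : {s : S // f.1 * s = s}) : tmk P f (P.map m.op p) s = tmk P e p (lmul m s) :=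
  Quot.sound ⟨f, e, m, p, s, rfl, rfl⟩

/-- The right `S`-set `P ⊗ S`. -/
def coendSet : RSet S where
  carrier := Quot (PreRel P)
  act x t := Quot.lift (fun a : Pre P => tmk P a.1 a.2.1 (rmul a.2.2 t)) (by
    rintro a b ⟨f, e, m, p, s, rfl, rfl⟩
    refine (tmk_rel P m p (rmul s t)).trans ?_
    exact congrArg (tmk P e p) (Subtype.ext (mul_assoc _ _ _).symm)) x
  act_mul x s t := by
    obtain ⟨⟨e, p, r⟩, rfl⟩ := Quot.exists_rep x
    exact congrArg (tmk P e p) (Subtype.ext (mul_assoc _ _ _))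

theorem coend_act (e : CauchyCat S) (p : P.obj (Opposite.op e)) (s : {s : S // e.1 * s = s})
    (t : S) : (coendSet P).act (tmk P e p s) t = tmk P e p (rmul s t) := rfl

/-- `e` as an element of `eS`. -/
def eself (e : CauchyCat S) : {s : S // e.1 * s = s} := ⟨e.1, e.2⟩

theorem coend_closed (hS : ∀ s : S, ∃ e : S, e * e = e ∧ s * e = s) : (coendSet P).Closed := by
  constructor
  · let inv : (coendSet P).carrier → (coendSet P).Tensor :=
      Quot.lift (fun a : Pre P => Quot.mk _ (tmk P a.1 a.2.1 (eself a.1), a.2.2.1)) (by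
        rintro a b ⟨f, e, m, p, s, rfl, rfl⟩
        change Quot.mk _ (tmk P f (P.map m.op p) (eself f), s.1) =
          Quot.mk _ (tmk P e p (eself e), m.1 * s.1)
        have h : tmk P f (P.map m.op p) (eself f) = (coendSet P).act (tmk P e p (eself e)) m.1 := by
          rw [tmk_rel, coend_act]
          refine congrArg (tmk P e p) (Subtype.ext ?_)
          change m.1 * f.1 = e.1 * m.1
          rw [idem_left_absorb e.2 m.2, idem_right_absorb f.2 m.2]
        rw [h]
        exact Quot.sound ⟨_, _, _, rfl, rfl⟩)
    apply Function.LeftInverse.injective (g := inv)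
    intro q
    obtain ⟨⟨y, t⟩, rfl⟩ := Quot.exists_rep q
    obtain ⟨⟨e, p, s⟩, rfl⟩ := Quot.exists_rep y
    change Quot.mk _ (tmk P e p (eself e), s.1 * t) = Quot.mk _ (tmk P e p s, t)
    have h : tmk P e p s = (coendSet P).act (tmk P e p (eself e)) s.1 := by
      rw [coend_act]
      exact congrArg (tmk P e p) (Subtype.ext s.2.symm)
    rw [h]
    exact (Quot.sound ⟨_, _, _, rfl, rfl⟩).symm
  · intro x
    obtain ⟨⟨e, p, s⟩, rfl⟩ := Quot.exists_rep x
    obtain ⟨g, hg, hsg⟩ := hS s.1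
    refine ⟨Quot.mk _ (tmk P e p s, g), ?_⟩
    exact congrArg (tmk P e p) (Subtype.ext hsg)

/-- The morphism `g ⟶ e` given by `s * g`. -/
def homOf {e : CauchyCat S} (s : {s : S // e.1 * s = s}) (g : CauchyCat S) : g ⟶ e :=
  ⟨s.1 * g.1, by rw [← mul_assoc, s.2, mul_assoc, g.2]⟩

/-- Evaluation at `g`. -/
def evalAt (g : CauchyCat S) : (coendSet P).carrier → P.obj (Opposite.op g) :=
  Quot.lift (fun a : Pre P => P.map (homOf a.2.2 g).op a.2.1) (by
    rintro a b ⟨f, e, m, p, s, rfl, rfl⟩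
    change P.map (homOf s g).op (P.map m.op p) = P.map (homOf (lmul m s) g).op p
    have h : homOf (lmul m s) g = homOf s g ≫ m := Subtype.ext (mul_assoc _ _ _)
    rw [h, op_comp, Functor.map_comp_apply])

/-- The unit. -/
def coendUnit (hS : ∀ s : S, ∃ e : S, e * e = e ∧ s * e = s) :
    P ⟶ (fixFunctor S).obj ⟨coendSet P, coend_closed P hS⟩ where
  app e := TypeCat.ofHom fun p => ⟨tmk P e.unop p (eself e.unop),
    congrArg (tmk P e.unop p) (Subtype.ext e.unop.2)⟩
  naturality e f m := by
    ext p
    apply Subtype.ext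
    change tmk P f.unop (P.map m.unop.op p) (eself f.unop) =
      (coendSet P).act (tmk P e.unop p (eself e.unop)) m.unop.1
    rw [tmk_rel, coend_act]
    refine congrArg (tmk P e.unop p) (Subtype.ext ?_)
    change m.unop.1 * f.unop.1 = e.unop.1 * m.unop.1
    rw [idem_left_absorb e.unop.2 m.unop.2, idem_right_absorb f.unop.2 m.unop.2]

theorem fix_essSurj (hS : ∀ s : S, ∃ e : S, e * e = e ∧ s * e = s) :
    (fixFunctor S).EssSurj where
  mem_essImage P := by
    refine ⟨⟨coendSet P, coend_closed P hS⟩, ⟨?_⟩⟩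
    have : ∀ e, IsIso ((coendUnit P hS).app e) := by
      intro e
      rw [isIso_iff_bijective]
      constructor
      · apply Function.LeftInverse.injective (g := fun x => evalAt P e.unop x.1)
        intro p
        change P.map (homOf (eself e.unop) e.unop).op p = p
        have h : homOf (eself e.unop) e.unop = 𝟙 _ := Subtype.ext e.unop.2
        rw [h]
        exact Functor.map_id_apply P _ p
      · rintro ⟨x, hx⟩
        obtain ⟨⟨f, p, s⟩, rfl⟩ := Quot.exists_rep x
        refine ⟨P.map (homOf s e.unop).op p, Subtype.ext ?_⟩
        refine Eq.trans ?_ hx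
        change tmk P e.unop (P.map (homOf s e.unop).op p) (eself e.unop) =
          tmk P f p (rmul s e.unop.1)
        rw [tmk_rel]
        refine congrArg (tmk P f p) (Subtype.ext ?_)
        change s.1 * e.unop.1 * e.unop.1 = s.1 * e.unop.1
        rw [mul_assoc, e.unop.2]
    have : IsIso (coendUnit P hS) := NatIso.isIso_of_isIso_app _
    exact (asIso (coendUnit P hS)).symm

end EssSurj

/-- Closed right `S`-sets are presheaves on the Cauchy completion. -/
noncomputable def csetEquiv (hS : ∀ s : S, ∃ e : S, e * e = e ∧ s * e = s) :
    CSet S ≌ ((CauchyCat S)ᵒᵖ ⥤ Type u) :=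
  haveI := fix_full hS
  haveI := fix_faithful hS
  haveI := fix_essSurj hS
  haveI : (fixFunctor S).IsEquivalence := {}
  (fixFunctor S).asEquivalence

end RSet

/-- For semigroups with right local units, the categories of closed right sets are
equivalent if and only if there is a Morita context for the Cauchy completions. -/
theorem cset_equivalence_iff_moritaContext_cauchy
    (S T : Type u) [Semigroup S] [Semigroup T]
    (hS : ∀ s : S, ∃ e : S, e * e = e ∧ s * e = s)
    (hT : ∀ t : T, ∃ e : T, e * e = e ∧ t * e = t) :
    Nonempty (CSet S ≌ CSet T) ↔ MoritaContext (CauchyCat S) (CauchyCat T) := by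
  constructor
  · rintro ⟨E⟩
    exact moritaContext_of_presheaf_equiv
      ((RSet.csetEquiv hS).symm.trans (E.trans (RSet.csetEquiv hT)))
  · rintro ⟨U, instU, F, G, h1, h2, h3, h4, h5, h6⟩
    have : F.IsEquivalence := {}
    have : G.IsEquivalence := {}
    let K : CauchyCat S ≌ CauchyCat T := F.asEquivalence.trans G.asEquivalence.symm
    exact ⟨(RSet.csetEquiv hS).trans (K.op.congrLeft.trans (RSet.csetEquiv hT).symm)⟩
end

section
/- Inverse semigroups S and T are strongly Morita equivalent if and only if there exists a regular semigroup R containing isomorphic copies of S and T as subsemigroups such that R is a joint enlargement of S and T. -/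
universe u

open CategoryTheory

open InverseSemigroup

/-- The underlying set of the joint enlargement. -/
inductive Link (S T X : Type u) : Type u
  | s : S → Link S T X
  | x : X → Link S T X
  | b : X → Link S T X
  | t : T → Link S T X

/-- The product, using the base point `x0` as a sandwich element. -/
def Link.mul {S T X : Type u} [InverseSemigroup S] [InverseSemigroup T]
    (smul : S → X → X) (tmul : X → T → X) (inn : X → X → S) (brk : X → X → T) (x0 : X) :
    Link S T X → Link S T X → Link S T X
  | .s a, .s c => .s (a * c)
  | .s a, .x y => .x (smul a y)
  | .s a, .b y => .s (inn (smul a x0) y)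
  | .s a, .t c => .x (tmul (smul a x0) c)
  | .x y, .s a => .s (inn y x0 * a)
  | .x y, .x z => .x (smul (inn y x0) z)
  | .x y, .b z => .s (inn y z)
  | .x y, .t c => .x (tmul y c)
  | .b y, .s a => .b (smul (star a) y)
  | .b y, .x z => .t (brk y z)
  | .b y, .b z => .b (tmul z (brk x0 y))
  | .b y, .t c => .t (brk y x0 * c)
  | .t c, .s a => .b (smul (star a) (tmul x0 (star c)))
  | .t c, .x y => .t (c * brk x0 y)
  | .t c, .b y => .b (tmul y (star c))
  | .t c, .t d => .t (c * d)

theorem forward (S T : Type u) [InverseSemigroup S] [InverseSemigroup T] {X : Type u}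
    (smul : S → X → X) (tmul : X → T → X) (inn : X → X → S) (brk : X → X → T)
    (h : (∀ (s₁ s₂ : S) (x : X), smul (s₁ * s₂) x = smul s₁ (smul s₂ x)) ∧
    (∀ (x : X) (t₁ t₂ : T), tmul (tmul x t₁) t₂ = tmul x (t₁ * t₂)) ∧
    (∀ (s : S) (x : X) (t : T), tmul (smul s x) t = smul s (tmul x t)) ∧
    (Function.Surjective fun p : X × X => inn p.1 p.2) ∧
    (Function.Surjective fun p : X × X => brk p.1 p.2) ∧
    (∀ (s : S) (x y : X), inn (smul s x) y = s * inn x y) ∧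
    (∀ x y : X, inn y x = star (inn x y)) ∧
    (∀ x : X, smul (inn x x) x = x) ∧
    (∀ (x y : X) (t : T), brk x (tmul y t) = brk x y * t) ∧
    (∀ x y : X, brk x y = star (brk y x)) ∧
    (∀ x : X, tmul x (brk x x) = x) ∧
    (∀ x y z : X, smul (inn x y) z = tmul x (brk y z))) :
      ∃ (R : Type u) (_ : Semigroup R) (ι : S → R) (κ : T → R),
        Function.Injective ι ∧ Function.Injective κ ∧
        (∀ a b : S, ι (a * b) = ι a * ι b) ∧
        (∀ a b : T, κ (a * b) = κ a * κ b) ∧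
        (∀ r : R, ∃ r' : R, r * r' * r = r ∧ r' * r * r' = r') ∧
        (∀ (a b : S) (r : R), ∃ c : S, ι a * r * ι b = ι c) ∧
        (∀ a : S, ∃ (b c : S) (r : R), ι a = ι b * r * ι c) ∧
        (∀ r : R, ∃ (r₁ r₂ : R) (a : S), r = r₁ * ι a * r₂) ∧
        (∀ (a b : T) (r : R), ∃ c : T, κ a * r * κ b = κ c) ∧
        (∀ a : T, ∃ (b c : T) (r : R), κ a = κ b * r * κ c) ∧
        (∀ r : R, ∃ (r₁ r₂ : R) (a : T), r = r₁ * κ a * r₂) := by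
  obtain ⟨hs, ht, hst, surI, surB, M1, M2, M3, M4, M5, M6, M7⟩ := h
  by_cases hX : Nonempty X
  swap
  · have hS : IsEmpty S := ⟨fun s => hX ⟨(surI s).choose.1⟩⟩
    have hT : IsEmpty T := ⟨fun s => hX ⟨(surB s).choose.1⟩⟩
    refine ⟨PEmpty, { mul := fun a _ => a, mul_assoc := fun a => a.elim },
      fun s => hS.elim s, fun s => hT.elim s, ?_, ?_, ?_, ?_, ?_, ?_, ?_, ?_, ?_, ?_, ?_⟩
    all_goals intro a; first | exact hS.elim a | exact hT.elim a | exact a.elim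
  obtain ⟨x0⟩ := hX
  have M1' : ∀ (s : S) (x y : X), inn x (smul s y) = inn x y * star s := by
    intro s x y
    rw [M2, M1, InverseSemigroup.star_mul, ← M2]
  have M4' : ∀ (x y : X) (t : T), brk (tmul x t) y = star t * brk x y := by
    intro x y t
    rw [M5, M4, InverseSemigroup.star_mul, ← M5]
  have A1 : ∀ (x y : X) (t : T), inn (tmul x t) y = inn x (tmul y (star t)) := by
    intro x y t
    obtain ⟨⟨u, v⟩, rfl⟩ := surB t
    simp only
    rw [← M5, ← M7, ← M7, M1, M1', ← M2]
  have A2 : ∀ (x y : X) (s : S), brk (smul s x) y = brk x (smul (star s) y) := by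
    intro x y s
    obtain ⟨⟨u, v⟩, rfl⟩ := surI s
    simp only
    rw [← M2, M7, M7, M4, M4', ← M5]
  have I2 : ∀ x y : X, star (inn x y) = inn y x := fun x y => (M2 x y).symm
  have B2 : ∀ x y : X, star (brk x y) = brk y x := fun x y => (M5 y x).symm
  have hst' : ∀ (s : S) (x : X) (t : T), smul s (tmul x t) = tmul (smul s x) t :=
    fun s x t => (hst s x t).symm
  have C1 : ∀ a c x y : X, inn a (tmul c (brk x y)) = inn a y * inn x c := by
    intro a c x y
    rw [← M7, M1', I2]
  have C2 : ∀ (a c x y : X) (t : T),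
      inn a (tmul c (brk x y * t)) = inn a (tmul y t) * inn x c := by
    intro a c x y t
    rw [← M4, C1]
  have C3 : ∀ (a c x y : X) (t : T),
      inn a (tmul c (t * brk x y)) = inn a y * inn x (tmul c t) := by
    intro a c x y t
    rw [← ht, C1]
  have C4 : ∀ (a x : X) (s : S) (t : T),
      inn a (tmul (smul s x) t) = inn a (tmul x t) * star s := by
    intro a x s t
    rw [hst, M1']
  letI inst : Semigroup (Link S T X) :=
    { mul := Link.mul smul tmul inn brk x0
      mul_assoc := by
        intro a b c
        change Link.mul smul tmul inn brk x0 (Link.mul smul tmul inn brk x0 a b) c =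
          Link.mul smul tmul inn brk x0 a (Link.mul smul tmul inn brk x0 b c)
        rcases a with a | a | a | a <;> rcases b with b | b | b | b <;>
          rcases c with c | c | c | c <;>
          simp only [Link.mul, mul_assoc, hs, ht, hst', C1, C2, C3, C4, M1, M1', M4, M4', A1, A2, I2, B2, InverseSemigroup.star_mul,
            InverseSemigroup.star_star, M7] }
  have mul_def : ∀ a b : Link S T X, a * b = Link.mul smul tmul inn brk x0 a b := fun _ _ => rfl
  have sss : ∀ a : S, a * (star a * a) = a := fun a => by rw [← mul_assoc, mul_star_mul]
  have ttt : ∀ a : T, a * (star a * a) = a := fun a => by rw [← mul_assoc, mul_star_mul]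
  have M6' : ∀ x y, brk x x * brk x y = brk x y := by
    intro x y; rw [← B2 x x, ← M4', M6]
  have M3' : ∀ x y, inn y x * inn x x = inn y x := by
    intro x y; rw [← I2 x x, ← M1', M3]
  refine ⟨Link S T X, inst, Link.s, Link.t, fun _ _ h => by cases h; rfl,
    fun _ _ h => by cases h; rfl, fun _ _ => rfl, fun _ _ => rfl, ?_, ?_, ?_, ?_, ?_, ?_, ?_⟩
  · rintro (a | a | a | a)
    · exact ⟨.s (star a), by simp only [mul_def, Link.mul, mul_star_mul],
        by simp only [mul_def, Link.mul, InverseSemigroup.star_mul_star]⟩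
    · exact ⟨.b a, by simp only [mul_def, Link.mul, M3], by simp only [mul_def, Link.mul, B2, M6]⟩
    · exact ⟨.x a, by simp only [mul_def, Link.mul, B2, M6], by simp only [mul_def, Link.mul, M3]⟩
    · exact ⟨.t (star a), by simp only [mul_def, Link.mul, mul_star_mul],
        by simp only [mul_def, Link.mul, InverseSemigroup.star_mul_star]⟩
  · rintro a b (r | r | r | r) <;> exact ⟨_, rfl⟩
  · exact fun a => ⟨a, a, .s (star a), by simp only [mul_def, Link.mul, mul_star_mul]⟩
  · rintro (a | a | a | a)
    · exact ⟨.s a, .s a, star a, by simp only [mul_def, Link.mul, mul_star_mul]⟩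
    · exact ⟨.s (inn a a), .x a, inn a a, by simp only [mul_def, Link.mul, hs, M3]⟩
    · exact ⟨.b a, .s (inn a a), inn a a, by simp only [mul_def, Link.mul, I2, M3]⟩
    · obtain ⟨⟨y, z⟩, rfl⟩ := surB a
      exact ⟨.b y, .x z, inn y y, by simp only [mul_def, Link.mul, I2, M3]⟩
  · rintro a b (r | r | r | r) <;> exact ⟨_, rfl⟩
  · exact fun a => ⟨a, a, .t (star a), by simp only [mul_def, Link.mul, mul_star_mul]⟩
  · rintro (a | a | a | a)
    · obtain ⟨⟨y, z⟩, rfl⟩ := surI a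
      exact ⟨.x y, .b z, brk y y, by simp only [mul_def, Link.mul, M6]⟩
    · exact ⟨.x a, .t (brk a a), brk a a, by simp only [mul_def, Link.mul, M6]⟩
    · exact ⟨.t (brk a a), .b a, brk a a, by simp only [mul_def, Link.mul, InverseSemigroup.star_mul, B2, ← ht, M6]⟩
    · exact ⟨.t a, .t a, star a, by simp only [mul_def, Link.mul, mul_star_mul]⟩

/-- Pairs of mutually inverse elements `p ∈ SRT`, `q ∈ TRS`. -/
def IsPair {S T R : Type u} [Semigroup R] (ι : S → R) (κ : T → R) (p q : R) : Prop :=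
  (∃ a, ι a * p = p) ∧ (∃ b, p * κ b = p) ∧ (∃ a, q * ι a = q) ∧ (∃ b, κ b * q = q) ∧
    p * q * p = p ∧ q * p * q = q

theorem idem_comm_image {S R : Type u} [InverseSemigroup S] [Semigroup R] (ι : S → R)
    (h1 : Function.Injective ι) (h3 : ∀ a b : S, ι (a * b) = ι a * ι b)
    {u v : R} (hu : ∃ c, u = ι c) (hv : ∃ c, v = ι c) (huu : u * u = u) (hvv : v * v = v) :
    u * v = v * u := by
  obtain ⟨c, rfl⟩ := hu
  obtain ⟨d, rfl⟩ := hv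
  rw [← h3] at huu hvv
  rw [← h3, ← h3, idem_comm (h1 huu) (h1 hvv)]

/-- If `q₁ p₁` and `q₂ p₂` commute then `p₁ q₂` and `p₂ q₁` are mutually inverse (one half). -/
theorem pair_inverse {R : Type u} [Semigroup R] {p₁ q₁ p₂ q₂ : R}
    (h₁ : p₁ * q₁ * p₁ = p₁) (h₂ : q₂ * p₂ * q₂ = q₂)
    (hc : (q₂ * p₂) * (q₁ * p₁) = (q₁ * p₁) * (q₂ * p₂)) :
    (p₁ * q₂) * (p₂ * q₁) * (p₁ * q₂) = p₁ * q₂ := by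
  calc (p₁ * q₂) * (p₂ * q₁) * (p₁ * q₂) = p₁ * ((q₂ * p₂) * (q₁ * p₁)) * q₂ := by
        simp only [mul_assoc]
    _ = (p₁ * q₁ * p₁) * (q₂ * p₂ * q₂) := by rw [hc]; simp only [mul_assoc]
    _ = p₁ * q₂ := by rw [h₁, h₂]

theorem backward (S T : Type u) [InverseSemigroup S] [InverseSemigroup T] (R : Type u)
    [Semigroup R] (ι : S → R) (κ : T → R)
    (h1 : Function.Injective ι) (h2 : Function.Injective κ)
    (h3 : ∀ a b : S, ι (a * b) = ι a * ι b)
    (h4 : ∀ a b : T, κ (a * b) = κ a * κ b)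
    (h6 : ∀ (a b : S) (r : R), ∃ c : S, ι a * r * ι b = ι c)
    (h8 : ∀ r : R, ∃ (r₁ r₂ : R) (a : S), r = r₁ * ι a * r₂)
    (h9 : ∀ (a b : T) (r : R), ∃ c : T, κ a * r * κ b = κ c)
    (h11 : ∀ r : R, ∃ (r₁ r₂ : R) (a : T), r = r₁ * κ a * r₂) :
    StronglyMoritaEquivalent S T := by
  let X := {z : R × R // IsPair ι κ z.1 z.2}
  have inn_ex : ∀ z w : X, ∃ c, z.1.1 * w.1.2 = ι c := by
    rintro ⟨⟨p, q⟩, ⟨a, ha⟩, -⟩ ⟨⟨p', q'⟩, -, -, ⟨b, hb⟩, -⟩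
    dsimp only at *
    obtain ⟨c, hc⟩ := h6 a b (p * q')
    refine ⟨c, ?_⟩
    rw [← hc, ← mul_assoc, ha, mul_assoc, hb]
  have brk_ex : ∀ z w : X, ∃ c, z.1.2 * w.1.1 = κ c := by
    rintro ⟨⟨p, q⟩, -, -, -, ⟨a, ha⟩, -⟩ ⟨⟨p', q'⟩, -, ⟨b, hb⟩, -⟩
    dsimp only at *
    obtain ⟨c, hc⟩ := h9 a b (q * p')
    refine ⟨c, ?_⟩
    rw [← hc, ← mul_assoc, ha, mul_assoc, hb]
  have cS : ∀ (z w : X), (z.1.1 * z.1.2) * (w.1.1 * w.1.2) = (w.1.1 * w.1.2) * (z.1.1 * z.1.2) := by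
    intro z w
    apply idem_comm_image ι h1 h3 (inn_ex z z) (inn_ex w w)
    · rw [← mul_assoc, z.2.2.2.2.2.1]
    · rw [← mul_assoc, w.2.2.2.2.2.1]
  have cT : ∀ (z w : X), (z.1.2 * z.1.1) * (w.1.2 * w.1.1) = (w.1.2 * w.1.1) * (z.1.2 * z.1.1) := by
    intro z w
    apply idem_comm_image κ h2 h4 (brk_ex z z) (brk_ex w w)
    · rw [← mul_assoc, z.2.2.2.2.2.2]
    · rw [← mul_assoc, w.2.2.2.2.2.2]
  have cSs : ∀ (z : X) (s : S), (z.1.1 * z.1.2) * (ι (star s) * ι s) =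
      (ι (star s) * ι s) * (z.1.1 * z.1.2) := by
    intro z s
    apply idem_comm_image ι h1 h3 (inn_ex z z) ⟨_, (h3 _ _).symm⟩
    · rw [← mul_assoc, z.2.2.2.2.2.1]
    · rw [← h3, ← h3, star_mul_self_idem]
  have cTt : ∀ (z : X) (t : T), (z.1.2 * z.1.1) * (κ t * κ (star t)) =
      (κ t * κ (star t)) * (z.1.2 * z.1.1) := by
    intro z t
    apply idem_comm_image κ h2 h4 (brk_ex z z) ⟨_, (h4 _ _).symm⟩
    · rw [← mul_assoc, z.2.2.2.2.2.2]
    · rw [← h4, ← h4, mul_star_self_idem]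
  have ιs : ∀ s, ι s * ι (star s) * ι s = ι s := fun s => by rw [← h3, ← h3, mul_star_mul]
  have ιs' : ∀ s, ι (star s) * ι s * ι (star s) = ι (star s) := fun s => by
    rw [← h3, ← h3, InverseSemigroup.star_mul_star]
  have κs : ∀ s, κ s * κ (star s) * κ s = κ s := fun s => by rw [← h4, ← h4, mul_star_mul]
  have κs' : ∀ s, κ (star s) * κ s * κ (star s) = κ (star s) := fun s => by
    rw [← h4, ← h4, InverseSemigroup.star_mul_star]
  choose inn hinn using inn_ex
  choose brk hbrk using brk_ex
  have smul_ok : ∀ (s : S) (z : X), IsPair ι κ (ι s * z.1.1) (z.1.2 * ι (star s)) := by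
    intro s z
    have hc := cSs z s
    obtain ⟨⟨p, q⟩, ⟨a, ha⟩, ⟨b, hb⟩, ⟨c, hc'⟩, ⟨d, hd⟩, h, h'⟩ := z
    dsimp only at *
    refine ⟨⟨s * star s, ?_⟩, ⟨b, ?_⟩, ⟨s * star s, ?_⟩, ⟨d, ?_⟩, ?_, ?_⟩
    · rw [h3, ← mul_assoc, ιs]
    · rw [mul_assoc, hb]
    · rw [h3, mul_assoc, ← mul_assoc (ι (star s)), ιs']
    · rw [← mul_assoc, hd]
    · exact pair_inverse (ιs s) h hc
    · exact pair_inverse h' (ιs' s) hc.symm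
  have tmul_ok : ∀ (z : X) (t : T), IsPair ι κ (z.1.1 * κ t) (κ (star t) * z.1.2) := by
    intro z t
    have hc := cTt z t
    obtain ⟨⟨p, q⟩, ⟨a, ha⟩, ⟨b, hb⟩, ⟨c, hc'⟩, ⟨d, hd⟩, h, h'⟩ := z
    dsimp only at *
    refine ⟨⟨a, ?_⟩, ⟨star t * t, ?_⟩, ⟨c, ?_⟩, ⟨star t * t, ?_⟩, ?_, ?_⟩
    · rw [← mul_assoc, ha]
    · rw [h4, mul_assoc, ← mul_assoc (κ t), κs]
    · rw [mul_assoc, hc']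
    · rw [h4, ← mul_assoc, κs']
    · exact pair_inverse h (κs t) hc.symm
    · exact pair_inverse (κs' t) h' hc
  let smul : S → X → X := fun s z => ⟨(ι s * z.1.1, z.1.2 * ι (star s)), smul_ok s z⟩
  let tmul : X → T → X := fun z t => ⟨(z.1.1 * κ t, κ (star t) * z.1.2), tmul_ok z t⟩
  have M2 : ∀ x y : X, inn y x = star (inn x y) := by
    intro x y
    apply star_unique <;> apply h1 <;> simp only [h3, ← hinn]
    · exact pair_inverse x.2.2.2.2.2.1 y.2.2.2.2.2.2 (cT y x)
    · exact pair_inverse y.2.2.2.2.2.1 x.2.2.2.2.2.2 (cT x y)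
  have M5 : ∀ x y : X, brk x y = star (brk y x) := by
    intro x y
    apply star_unique <;> apply h2 <;> simp only [h4, ← hbrk]
    · exact pair_inverse y.2.2.2.2.2.2 x.2.2.2.2.2.1 (cS x y)
    · exact pair_inverse x.2.2.2.2.2.2 y.2.2.2.2.2.1 (cS y x)
  have ext : ∀ x y : X, x.1.1 = y.1.1 → x.1.2 = y.1.2 → x = y := fun x y h h' =>
    Subtype.ext (Prod.ext h h')
  refine ⟨X, smul, tmul, inn, brk, ?_, ?_, ?_, ?_, ?_, ?_, M2, ?_, ?_, M5, ?_, ?_⟩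
  · intro a b x
    apply ext <;> simp only [smul, h3, InverseSemigroup.star_mul, mul_assoc]
  · intro x a b
    apply ext <;> simp only [tmul, h4, InverseSemigroup.star_mul, mul_assoc]
  · intro a x b
    apply ext <;> simp only [smul, tmul, mul_assoc]
  · intro s
    obtain ⟨r₁, r₂, t, ht⟩ := h11 (ι (star s * s))
    set e := ι (star s * s) with he
    have hee : e * e = e := by rw [he, ← h3, star_mul_self_idem]
    have hxy : (e * r₁ * κ t * κ (star t)) * (κ t * r₂ * e) = e := by
      calc _ = e * r₁ * (κ t * κ (star t) * κ t) * r₂ * e := by simp only [mul_assoc]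
        _ = e * (r₁ * κ t * r₂) * e := by rw [κs]; simp only [mul_assoc]
        _ = e := by rw [← ht, hee, hee]
    have hex : e * (e * r₁ * κ t * κ (star t)) = e * r₁ * κ t * κ (star t) := by
      simp only [← mul_assoc, hee]
    have hye : (κ t * r₂ * e) * e = κ t * r₂ * e := by rw [mul_assoc, hee]
    have hp : IsPair ι κ (e * r₁ * κ t * κ (star t)) (κ t * r₂ * e) := by
      refine ⟨⟨_, hex⟩, ⟨t * star t, ?_⟩, ⟨_, hye⟩, ⟨t * star t, ?_⟩, ?_, ?_⟩
      · rw [h4, mul_assoc (e * r₁), mul_assoc (e * r₁), ← h4, ← h4, mul_star_self_idem]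
      · rw [h4, mul_assoc (κ t) r₂, ← mul_assoc _ (κ t), κs]
      · rw [hxy, hex]
      · rw [mul_assoc, hxy, hye]
    refine ⟨(smul s ⟨(_, _), hp⟩, ⟨(_, _), hp⟩), ?_⟩
    apply h1
    simp only
    rw [← hinn]
    simp only [smul]
    rw [mul_assoc, hxy, he, ← h3, ← mul_assoc, mul_star_mul]
  · intro s
    obtain ⟨r₁, r₂, t, ht⟩ := h8 (κ (s * star s))
    set e := κ (s * star s) with he
    have hee : e * e = e := by rw [he, ← h4, mul_star_self_idem]
    have hxy : (e * r₁ * ι t * ι (star t)) * (ι t * r₂ * e) = e := by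
      calc _ = e * r₁ * (ι t * ι (star t) * ι t) * r₂ * e := by simp only [mul_assoc]
        _ = e * (r₁ * ι t * r₂) * e := by rw [ιs]; simp only [mul_assoc]
        _ = e := by rw [← ht, hee, hee]
    have hex : e * (e * r₁ * ι t * ι (star t)) = e * r₁ * ι t * ι (star t) := by
      simp only [← mul_assoc, hee]
    have hye : (ι t * r₂ * e) * e = ι t * r₂ * e := by rw [mul_assoc, hee]
    have hp : IsPair ι κ (ι t * r₂ * e) (e * r₁ * ι t * ι (star t)) := by
      refine ⟨⟨t * star t, ?_⟩, ⟨_, hye⟩, ⟨t * star t, ?_⟩, ⟨_, hex⟩, ?_, ?_⟩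
      · rw [h3, mul_assoc (ι t) r₂, ← mul_assoc _ (ι t), ιs]
      · rw [h3, mul_assoc (e * r₁), mul_assoc (e * r₁), ← h3, ← h3, mul_star_self_idem]
      · rw [mul_assoc, hxy, hye]
      · rw [hxy, hex]
    refine ⟨(⟨(_, _), hp⟩, tmul ⟨(_, _), hp⟩ s), ?_⟩
    apply h2
    simp only
    rw [← hbrk]
    simp only [tmul]
    rw [← mul_assoc, hxy, he, ← h4, mul_star_mul]
  · intro s x y
    apply h1
    rw [h3, ← hinn, ← hinn]
    simp only [smul, mul_assoc]
  · intro x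
    apply ext <;> simp only [smul]
    · rw [← hinn, x.2.2.2.2.2.1]
    · rw [← M2, ← hinn, ← mul_assoc, x.2.2.2.2.2.2]
  · intro x y t
    apply h2
    rw [h4, ← hbrk, ← hbrk]
    simp only [tmul, mul_assoc]
  · intro x
    apply ext <;> simp only [tmul]
    · rw [← hbrk, ← mul_assoc, x.2.2.2.2.2.1]
    · rw [← M5, ← hbrk, x.2.2.2.2.2.2]
  · intro x y z
    apply ext <;> simp only [smul, tmul]
    · rw [← hbrk, ← hinn, mul_assoc]
    · rw [← M2, ← M5, ← hbrk, ← hinn, mul_assoc]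

/-- Inverse semigroups `S` and `T` are strongly Morita equivalent if and only if
there is a regular semigroup `R` containing isomorphic copies of `S` and `T` as
subsemigroups which is a joint enlargement of them: `S = SRS`, `T = TRT`,
`R = RSR` and `R = RTR`. -/
theorem stronglyMoritaEquivalent_iff_regular_joint_enlargement
    (S T : Type u) [InverseSemigroup S] [InverseSemigroup T] :
    StronglyMoritaEquivalent S T ↔
      ∃ (R : Type u) (_ : Semigroup R) (ι : S → R) (κ : T → R),
        Function.Injective ι ∧ Function.Injective κ ∧
        (∀ a b : S, ι (a * b) = ι a * ι b) ∧
        (∀ a b : T, κ (a * b) = κ a * κ b) ∧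
        -- R is regular
        (∀ r : R, ∃ r' : R, r * r' * r = r ∧ r' * r * r' = r') ∧
        -- S = S R S
        (∀ (a b : S) (r : R), ∃ c : S, ι a * r * ι b = ι c) ∧
        (∀ a : S, ∃ (b c : S) (r : R), ι a = ι b * r * ι c) ∧
        -- R = R S R
        (∀ r : R, ∃ (r₁ r₂ : R) (a : S), r = r₁ * ι a * r₂) ∧
        -- T = T R T
        (∀ (a b : T) (r : R), ∃ c : T, κ a * r * κ b = κ c) ∧
        (∀ a : T, ∃ (b c : T) (r : R), κ a = κ b * r * κ c) ∧
        -- R = R T R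
        (∀ r : R, ∃ (r₁ r₂ : R) (a : T), r = r₁ * κ a * r₂) := by
  constructor
  · rintro ⟨X, smul, tmul, inn, brk, h⟩
    exact forward S T smul tmul inn brk h
  · rintro ⟨R, inst, ι, κ, h1, h2, h3, h4, h5, h6, h7, h8, h9, h10, h11⟩
    exact backward S T R ι κ h1 h2 h3 h4 h6 h8 h9 h11
end
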